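/- arXiv:2103.04734 — 5 statements merged into one kernel-verified Lean document; each statement's English description precedes it below -/
import Mathlib

section
/- Let G be an admissible transformed solution and let τ₁ > 0. Then there exists a constant C₀ ≥ 0 such that for all 0 < τ < τ₁ the norm ‖G(·,τ)‖ := (∫_{−1/(6τ²)}^{+∞} |G(η,τ)|² dη)^{1/2} equals C₀; that is, the L² norm of G(·,τ) over (−1/(6τ²), +∞) is independent of τ. -/
open MeasureTheory Filter Set Function

noncomputable section

/-- Partial derivative in the first variable. -/
def pdX (f : ℝ → ℝ → ℂ) : ℝ → ℝ → ℂ := fun x t => deriv (fun y => f y t) x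

/-- Partial derivative in the second variable. -/
def pdT (f : ℝ → ℝ → ℂ) : ℝ → ℝ → ℂ := fun x t => deriv (fun s => f x s) t

/-- L² norm over the half-line (0,∞). -/
def L2h (f : ℝ → ℂ) : ℝ := Real.sqrt (∫ x in Set.Ioi (0:ℝ), ‖f x‖^2)

/-- L² norm over ℝ. -/
def L2R (f : ℝ → ℂ) : ℝ := Real.sqrt (∫ x : ℝ, ‖f x‖^2)

/-- An admissible transformed solution: infinitely smooth on
Ω̃ ∪ l = {(η,τ) : τ > 0, η ≥ -1/(6τ²)}, satisfying i G_τ - (1/2) G_ηη = 0 in Ω̃,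
vanishing on the boundary curve l, with super-algebraic decay as η → +∞
uniformly on compact τ-intervals in (0,∞). -/
structure IsAdmissibleTr (G : ℝ → ℝ → ℂ) : Prop where
  smooth : ContDiffOn ℝ (⊤ : ℕ∞) (Function.uncurry G)
    {p : ℝ × ℝ | 0 < p.2 ∧ -1/(6*p.2^2) ≤ p.1}
  eqn : ∀ η τ : ℝ, 0 < τ → -1/(6*τ^2) < η →
    Complex.I * pdT G η τ - (1/2) * pdX (pdX G) η τ = 0
  bc : ∀ τ : ℝ, 0 < τ → G (-1/(6*τ^2)) τ = 0
  decay : ∀ (α β γ : ℕ) (δ τ₁ : ℝ), 0 < δ → δ < τ₁ → ∀ ε > 0, ∃ X : ℝ, ∀ η ≥ X,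
    ∀ τ ∈ Set.Icc δ τ₁, η ^ α * ‖(pdT^[β] (pdX^[γ] G)) η τ‖ < ε

/-- The L² norm in η over (-1/(6τ²), +∞). -/
def trNorm (G : ℝ → ℝ → ℂ) (τ : ℝ) : ℝ :=
  Real.sqrt (∫ η in Set.Ioi (-1/(6*τ^2)), ‖G η τ‖^2)

/-- `G` in the moving frame where the boundary curve becomes `x = 0`. -/
def trShift (G : ℝ → ℝ → ℂ) (p : ℝ × ℝ) : ℂ := G (p.1 + -1/(6*p.2^2)) p.2

/-- The first-variable derivative of `trShift G`, extended continuously to `x = 0`. -/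
def trDeriv (G : ℝ → ℝ → ℂ) (p : ℝ × ℝ) : ℂ :=
  fderivWithin ℝ (trShift G) (Ici 0 ×ˢ Ioi 0) p (1, 0)

/-- The squared modulus of `G` in the moving frame. -/
def trDensity (G : ℝ → ℝ → ℂ) (p : ℝ × ℝ) : ℂ := star (trShift G p) * trShift G p

/-- The flux associated with `trDensity`. -/
def trFlux (G : ℝ → ℝ → ℂ) (p : ℝ × ℝ) : ℂ :=
  -(((1/(3*p.2^3) : ℝ) : ℂ) * (star (trShift G p) * trShift G p)
    + (-Complex.I/2) * (star (trShift G p) * trDeriv G p - trShift G p * star (trDeriv G p)))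

lemma hasDerivAt_trBoundary {t : ℝ} (ht : 0 < t) :
    HasDerivAt (fun t : ℝ => -1/(6*t^2)) (1/(3*t^3)) t := by
  have h := (hasDerivAt_const t (-1:ℝ)).fun_div (((hasDerivAt_id t).fun_pow 2).const_mul 6)
    (by simp [ht.ne'])
  refine h.congr_deriv ?_
  simp only [id]
  field_simp
  norm_num
  ring

lemma isOpen_trInterior : IsOpen {p : ℝ × ℝ | 0 < p.2 ∧ -1/(6*p.2^2) < p.1} := by
  have h : {p : ℝ × ℝ | 0 < p.2 ∧ -1/(6*p.2^2) < p.1}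
      = {p : ℝ × ℝ | 0 < p.2} ∩ {p : ℝ × ℝ | -1 < p.1 * (6*p.2^2)} := by
    ext p
    refine and_congr_right fun hp => ?_
    have : (0:ℝ) < 6*p.2^2 := by positivity
    exact div_lt_iff₀ this
  rw [h]
  exact (isOpen_lt (by fun_prop) (by fun_prop)).inter (isOpen_lt (by fun_prop) (by fun_prop))

lemma trQuadrant_mem_nhds {p : ℝ × ℝ} (hx : 0 < p.1) (ht : 0 < p.2) :
    Ici (0:ℝ) ×ˢ Ioi (0:ℝ) ∈ nhds p :=
  prod_mem_nhds (Ici_mem_nhds hx) (Ioi_mem_nhds ht)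

namespace IsAdmissibleTr

variable {G : ℝ → ℝ → ℂ}

lemma contDiffAt (hG : IsAdmissibleTr G) {η τ : ℝ} (h0 : 0 < τ) (h1 : -1/(6*τ^2) < η) :
    ContDiffAt ℝ (⊤ : ℕ∞) (uncurry G) (η, τ) :=
  hG.smooth.contDiffAt <| mem_of_superset
    (isOpen_trInterior.mem_nhds (x := (η, τ)) ⟨h0, h1⟩) fun _ hq => ⟨hq.1, hq.2.le⟩

lemma contDiffOn_trShift (hG : IsAdmissibleTr G) :
    ContDiffOn ℝ (⊤ : ℕ∞) (trShift G) (Ici 0 ×ˢ Ioi 0) := by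
  have hs : ContDiffOn ℝ (⊤ : ℕ∞) (fun p : ℝ × ℝ => (p.1 + -1/(6*p.2^2), p.2))
      (Ici 0 ×ˢ Ioi 0) := by
    refine ContDiffOn.prodMk (contDiffOn_fst.add (ContDiffOn.div contDiffOn_const
      (by fun_prop) fun p hp => ?_)) contDiffOn_snd
    have : (0:ℝ) < p.2 := hp.2
    positivity
  exact hG.smooth.comp hs fun p hp => ⟨hp.2, by simpa using hp.1⟩

lemma continuousOn_trShift (hG : IsAdmissibleTr G) : ContinuousOn (trShift G) (Ici 0 ×ˢ Ioi 0) :=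
  hG.contDiffOn_trShift.continuousOn

lemma continuousOn_trDeriv (hG : IsAdmissibleTr G) : ContinuousOn (trDeriv G) (Ici 0 ×ˢ Ioi 0) :=
  (hG.contDiffOn_trShift.continuousOn_fderivWithin
    ((uniqueDiffOn_Ici 0).prod isOpen_Ioi.uniqueDiffOn) (by simp)).clm_apply continuousOn_const

lemma continuousOn_trDensity (hG : IsAdmissibleTr G) :
    ContinuousOn (trDensity G) (Ici 0 ×ˢ Ioi 0) :=
  hG.continuousOn_trShift.star.mul hG.continuousOn_trShift

lemma continuousOn_trFlux (hG : IsAdmissibleTr G) : ContinuousOn (trFlux G) (Ici 0 ×ˢ Ioi 0) := by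
  have hH := hG.continuousOn_trShift
  have hD := hG.continuousOn_trDeriv
  have hc : ContinuousOn (fun p : ℝ × ℝ => ((1/(3*p.2^3) : ℝ) : ℂ)) (Ici 0 ×ˢ Ioi 0) := by
    refine Complex.continuous_ofReal.comp_continuousOn
      (ContinuousOn.div (by fun_prop) (by fun_prop) fun p hp => ?_)
    have : (0:ℝ) < p.2 := hp.2
    positivity
  exact ((hc.mul (hH.star.mul hH)).add
    (continuousOn_const.mul ((hH.star.mul hD).sub (hH.mul hD.star)))).neg

lemma contDiffAt_trShift (hG : IsAdmissibleTr G) {p : ℝ × ℝ} (hx : 0 < p.1) (ht : 0 < p.2) :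
    ContDiffAt ℝ (⊤ : ℕ∞) (trShift G) p :=
  hG.contDiffOn_trShift.contDiffAt (trQuadrant_mem_nhds hx ht)

lemma differentiableAt_trShift (hG : IsAdmissibleTr G) {p : ℝ × ℝ} (hx : 0 < p.1) (ht : 0 < p.2) :
    DifferentiableAt ℝ (trShift G) p :=
  (hG.contDiffAt_trShift hx ht).differentiableAt (by simp)

lemma differentiableAt_trDeriv (hG : IsAdmissibleTr G) {p : ℝ × ℝ} (hx : 0 < p.1) (ht : 0 < p.2) :
    DifferentiableAt ℝ (trDeriv G) p := by
  have h : ContDiffAt ℝ 1 (fderiv ℝ (trShift G)) p :=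
    (hG.contDiffAt_trShift hx ht).fderiv_right (by norm_cast)
  refine ((h.differentiableAt (by simp)).clm_apply
    (differentiableAt_const ((1:ℝ), (0:ℝ)))).congr_of_eventuallyEq ?_
  have ho : Ioi (0:ℝ) ×ˢ Ioi (0:ℝ) ∈ nhds p := prod_mem_nhds (Ioi_mem_nhds hx) (Ioi_mem_nhds ht)
  filter_upwards [ho] with q hq
  rw [trDeriv, fderivWithin_of_mem_nhds (trQuadrant_mem_nhds hq.1 hq.2)]

lemma trDeriv_eq (hG : IsAdmissibleTr G) {x t : ℝ} (hx : 0 < x) (ht : 0 < t) :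
    trDeriv G (x, t) = pdX G (x + -1/(6*t^2)) t := by
  have h := (hG.differentiableAt_trShift (p := (x, t)) hx ht).hasFDerivAt.comp_hasDerivAt x
    ((hasDerivAt_id x).prodMk (hasDerivAt_const x t))
  rw [trDeriv, fderivWithin_of_mem_nhds (trQuadrant_mem_nhds hx ht), ← h.deriv, pdX,
    ← deriv_comp_add_const]
  rfl

lemma hasDerivAt_trShift_fst (hG : IsAdmissibleTr G) {x t : ℝ} (hx : 0 < x) (ht : 0 < t) :
    HasDerivAt (fun y => trShift G (y, t)) (trDeriv G (x, t)) x := by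
  have h := (hG.differentiableAt_trShift (p := (x, t)) hx ht).hasFDerivAt.comp_hasDerivAt x
    ((hasDerivAt_id x).prodMk (hasDerivAt_const x t))
  rwa [trDeriv, fderivWithin_of_mem_nhds (trQuadrant_mem_nhds hx ht)]

lemma hasDerivAt_trDeriv_fst (hG : IsAdmissibleTr G) {x t : ℝ} (hx : 0 < x) (ht : 0 < t) :
    HasDerivAt (fun y => trDeriv G (y, t)) (pdX (pdX G) (x + -1/(6*t^2)) t) x := by
  have h : DifferentiableAt ℝ (fun y => trDeriv G (y, t)) x :=
    (hG.differentiableAt_trDeriv (p := (x, t)) hx ht).comp x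
      (f := fun y : ℝ => (y, t)) (by fun_prop)
  refine h.hasDerivAt.congr_deriv ?_
  change _ = deriv (fun η => pdX G η t) _
  rw [← deriv_comp_add_const]
  refine Filter.EventuallyEq.deriv_eq ?_
  filter_upwards [Ioi_mem_nhds hx] with y hy
  exact hG.trDeriv_eq hy ht

lemma hasDerivAt_trShift_snd (hG : IsAdmissibleTr G) {x t : ℝ} (hx : 0 < x) (ht : 0 < t) :
    HasDerivAt (fun s => trShift G (x, s))
      (((1/(3*t^3) : ℝ) : ℂ) * trDeriv G (x, t) + pdT G (x + -1/(6*t^2)) t) t := by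
  have hd : HasFDerivAt (uncurry G) _ (x + -1/(6*t^2), t) :=
    ((hG.contDiffAt (η := x + -1/(6*t^2)) ht (by linarith)).differentiableAt
      (by simp)).hasFDerivAt
  have h1 := hd.comp_hasDerivAt (x + -1/(6*t^2))
    ((hasDerivAt_id (x + -1/(6*t^2))).prodMk (hasDerivAt_const _ t))
  have h2 := hd.comp_hasDerivAt t ((hasDerivAt_const t (x + -1/(6*t^2))).prodMk (hasDerivAt_id t))
  have h3 := hd.comp_hasDerivAt (f := fun s : ℝ => (x + -1/(6*s^2), s)) t
    (((hasDerivAt_trBoundary ht).const_add x).prodMk (hasDerivAt_id t))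
  have e1 : pdX G (x + -1/(6*t^2)) t = _ := h1.deriv
  have e2 : pdT G (x + -1/(6*t^2)) t = _ := h2.deriv
  rw [hG.trDeriv_eq hx ht, e1, e2]
  refine h3.congr_deriv ?_
  rw [← Complex.real_smul, ← map_smul, ← map_add]
  simp

lemma pdT_eq (hG : IsAdmissibleTr G) {η τ : ℝ} (h0 : 0 < τ) (h1 : -1/(6*τ^2) < η) :
    pdT G η τ = (-Complex.I/2) * pdX (pdX G) η τ := by
  linear_combination (-Complex.I) * hG.eqn η τ h0 h1 + pdT G η τ * Complex.I_mul_I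

lemma differentiableAt_trDensity (hG : IsAdmissibleTr G) {p : ℝ × ℝ} (hx : 0 < p.1) (ht : 0 < p.2) :
    DifferentiableAt ℝ (trDensity G) p :=
  (hG.differentiableAt_trShift hx ht).star.mul (hG.differentiableAt_trShift hx ht)

lemma differentiableAt_trFlux (hG : IsAdmissibleTr G) {p : ℝ × ℝ} (hx : 0 < p.1) (ht : 0 < p.2) :
    DifferentiableAt ℝ (trFlux G) p := by
  have hH := hG.differentiableAt_trShift hx ht
  have hD := hG.differentiableAt_trDeriv hx ht
  have hc : DifferentiableAt ℝ (fun p : ℝ × ℝ => ((1/(3*p.2^3) : ℝ) : ℂ)) p := by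
    have h : DifferentiableAt ℝ (fun p : ℝ × ℝ => 1/(3*p.2^3)) p :=
      by fun_prop (disch := positivity)
    exact Complex.ofRealCLM.differentiableAt.comp p h
  exact ((hc.mul (hH.star.mul hH)).add
    ((differentiableAt_const _).mul ((hH.star.mul hD).sub (hH.mul hD.star)))).neg

/-- The local conservation law for `trDensity`. -/
lemma fderiv_trFlux_add_fderiv_trDensity (hG : IsAdmissibleTr G)
    {p : ℝ × ℝ} (hx : 0 < p.1) (ht : 0 < p.2) :
    fderiv ℝ (trFlux G) p (1, 0) + fderiv ℝ (trDensity G) p (0, 1) = 0 := by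
  obtain ⟨x, t⟩ := p
  have h1 := (hG.differentiableAt_trFlux hx ht).hasFDerivAt.comp_hasDerivAt x
    ((hasDerivAt_id x).prodMk (hasDerivAt_const x t))
  have h2 := (hG.differentiableAt_trDensity hx ht).hasFDerivAt.comp_hasDerivAt t
    ((hasDerivAt_const t x).prodMk (hasDerivAt_id t))
  have hH := hG.hasDerivAt_trShift_fst hx ht
  have hD := hG.hasDerivAt_trDeriv_fst hx ht
  have hT := hG.hasDerivAt_trShift_snd hx ht
  have h3 := (((hH.star.mul hH).const_mul ((1/(3*t^3) : ℝ) : ℂ)).add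
    (((hH.star.mul hD).sub (hH.mul hD.star)).const_mul (-Complex.I/2))).neg
  have h4 := hT.star.mul hT
  rw [h1.unique h3, h2.unique h4, hG.pdT_eq ht (by simpa using hx)]
  simp only [star_add, star_mul', Complex.star_def, Complex.conj_ofReal, map_div₀, map_neg,
    Complex.conj_I, map_ofNat]
  ring

/-- Conservation on a bounded rectangle, with the flux through its right side. -/
lemma integral_trDensity_sub (hG : IsAdmissibleTr G)
    {R s T : ℝ} (hR : 0 < R) (hs : 0 < s) (hsT : s < T) :
    (∫ x in (0:ℝ)..R, trDensity G (x, T)) - (∫ x in (0:ℝ)..R, trDensity G (x, s))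
      = -∫ t in s..T, trFlux G (R, t) := by
  classical
  set U : Set (ℝ × ℝ) := Ioo 0 R ×ˢ Ioo s T
  have hpos : ∀ p ∈ U, 0 < p.1 ∧ 0 < p.2 := fun p hp => ⟨hp.1.1, hs.trans hp.2.1⟩
  have hsub : uIcc 0 R ×ˢ uIcc s T ⊆ Ici (0:ℝ) ×ˢ Ioi (0:ℝ) := by
    rw [uIcc_of_le hR.le, uIcc_of_le hsT.le]
    exact prod_mono (fun x hx => hx.1) fun t ht => hs.trans_le ht.1
  have hdiv : ∀ p, U.indicator (fderiv ℝ (trFlux G)) p (1, 0)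
      + U.indicator (fderiv ℝ (trDensity G)) p (0, 1) = 0 := by
    intro p
    by_cases hp : p ∈ U
    · simpa [hp] using hG.fderiv_trFlux_add_fderiv_trDensity (hpos p hp).1 (hpos p hp).2
    · simp [hp]
  have h := integral2_divergence_prod_of_hasFDerivAt_off_countable (trFlux G) (trDensity G)
    (U.indicator (fderiv ℝ (trFlux G))) (U.indicator (fderiv ℝ (trDensity G))) 0 s R T ∅
    countable_empty (hG.continuousOn_trFlux.mono hsub) (hG.continuousOn_trDensity.mono hsub)
    (by
      rw [min_eq_left hR.le, max_eq_right hR.le, min_eq_left hsT.le, max_eq_right hsT.le, sdiff_empty]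
      intro p hp
      rw [indicator_of_mem (show p ∈ U from hp)]
      exact (hG.differentiableAt_trFlux (hpos p hp).1 (hpos p hp).2).hasFDerivAt)
    (by
      rw [min_eq_left hR.le, max_eq_right hR.le, min_eq_left hsT.le, max_eq_right hsT.le, sdiff_empty]
      intro p hp
      rw [indicator_of_mem (show p ∈ U from hp)]
      exact (hG.differentiableAt_trDensity (hpos p hp).1 (hpos p hp).2).hasFDerivAt)
    (by simp only [hdiv]; exact integrableOn_zero)
  have h0 : ∫ t in s..T, trFlux G (0, t) = 0 := by
    rw [intervalIntegral.integral_congr (g := fun _ => 0), intervalIntegral.integral_zero]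
    intro t ht
    rw [uIcc_of_le hsT.le] at ht
    have : trShift G (0, t) = 0 := by
      simpa [trShift] using hG.bc t (hs.trans_le ht.1)
    simp [trFlux, this]
  simp only [hdiv, intervalIntegral.integral_zero, h0, sub_zero] at h
  linear_combination -h

lemma tendsto_integral_trFlux (hG : IsAdmissibleTr G) {s T : ℝ} (hs : 0 < s) (hsT : s < T) :
    Tendsto (fun R => ∫ t in s..T, trFlux G (R, t)) atTop (nhds 0) := by
  set A : ℝ := 1/(3*s^3) + 1 with hA
  have hA0 : 0 < A := by positivity
  have hTs : 0 < T - s := sub_pos.2 hsT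
  rw [Metric.tendsto_atTop]
  intro ε hε
  set κ : ℝ := min 1 (ε / (2 * (A * (T - s))))
  have hκ0 : 0 < κ := by positivity
  obtain ⟨X, hX⟩ := hG.decay 0 0 0 s T hs hsT κ hκ0
  obtain ⟨Y, hY⟩ := hG.decay 0 0 1 s T hs hsT κ hκ0
  refine ⟨max 1 (max X Y + 1/(6*s^2)), fun R hR => ?_⟩
  have hR0 : 0 < R := one_pos.trans_le ((le_max_left _ _).trans hR)
  have hRX := (le_max_right _ _).trans hR
  have hbound : ∀ t ∈ uIoc s T, ‖trFlux G (R, t)‖ ≤ A * κ := by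
    intro t ht
    rw [uIoc_of_le hsT.le] at ht
    have ht0 : 0 < t := hs.trans ht.1
    have hst : 1/(6*t^2) ≤ 1/(6*s^2) := by gcongr; exact ht.1.le
    have hst3 : 1/(3*t^3) ≤ 1/(3*s^3) := by gcongr; exact ht.1.le
    have hη : max X Y ≤ R + -1/(6*t^2) := by rw [neg_div]; linarith
    have hH : ‖trShift G (R, t)‖ ≤ κ := by
      simpa [trShift] using (hX _ ((le_max_left _ _).trans hη) t ⟨ht.1.le, ht.2⟩).le
    have hD : ‖trDeriv G (R, t)‖ ≤ κ := by
      rw [hG.trDeriv_eq hR0 ht0]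
      simpa using (hY _ ((le_max_right _ _).trans hη) t ⟨ht.1.le, ht.2⟩).le
    have hκ1 : κ * κ ≤ κ := mul_le_of_le_one_left hκ0.le (min_le_left _ _)
    rw [trFlux, norm_neg]
    have hHH : ‖trShift G (R, t)‖ * ‖trShift G (R, t)‖ ≤ κ :=
      (mul_le_mul hH hH (norm_nonneg _) hκ0.le).trans hκ1
    have hHD : ‖trShift G (R, t)‖ * ‖trDeriv G (R, t)‖ ≤ κ :=
      (mul_le_mul hH hD (norm_nonneg _) hκ0.le).trans hκ1
    have e1 : ‖((1/(3*t^3) : ℝ) : ℂ) * (star (trShift G (R, t)) * trShift G (R, t))‖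
        ≤ 1/(3*s^3) * κ := by
      rw [norm_mul, norm_mul, norm_star, Complex.norm_real, Real.norm_of_nonneg (by positivity)]
      gcongr
    have e2 : ‖star (trShift G (R, t)) * trDeriv G (R, t)
        - trShift G (R, t) * star (trDeriv G (R, t))‖ ≤ κ + κ := by
      refine (norm_sub_le _ _).trans (add_le_add ?_ ?_) <;> rwa [norm_mul, norm_star]
    have e3 : ‖(-Complex.I/2 : ℂ)‖ = 1/2 := by simp
    refine (norm_add_le _ _).trans ?_
    rw [norm_mul (-Complex.I/2), e3]
    calc _ ≤ 1/(3*s^3) * κ + 1/2 * (κ + κ) := by gcongr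
      _ = A * κ := by rw [hA]; ring
  rw [dist_zero_right]
  refine (intervalIntegral.norm_integral_le_of_norm_le_const hbound).trans_lt ?_
  rw [abs_of_pos hTs]
  calc A * κ * (T - s) ≤ A * (ε / (2 * (A * (T - s)))) * (T - s) := by
        gcongr; exact min_le_right _ _
    _ = ε / 2 := by field_simp
    _ < ε := half_lt_self hε

lemma continuousOn_section (hG : IsAdmissibleTr G) {τ : ℝ} (hτ : 0 < τ) :
    ContinuousOn (fun η => G η τ) (Ici (-1/(6*τ^2))) :=
  hG.smooth.continuousOn.comp (f := fun η : ℝ => (η, τ)) (by fun_prop) fun _ hη => ⟨hτ, hη⟩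

lemma integrableOn_normSq (hG : IsAdmissibleTr G) {τ : ℝ} (hτ : 0 < τ) :
    IntegrableOn (fun η => ‖G η τ‖^2) (Ioi (-1/(6*τ^2))) := by
  have hloc : LocallyIntegrableOn (fun η => ‖G η τ‖^2) (Ici (-1/(6*τ^2))) :=
    ((hG.continuousOn_section hτ).norm.pow 2).locallyIntegrableOn measurableSet_Ici
  obtain ⟨X, hX⟩ := hG.decay 1 0 0 τ (τ + 1) hτ (by linarith) 1 one_pos
  refine (hloc.integrableOn_of_isBigO_atTop (g := fun η : ℝ => η ^ (-2:ℝ)) ?_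
    ⟨Ioi 1, Ioi_mem_atTop 1, integrableOn_Ioi_rpow_of_lt (by norm_num) one_pos⟩).mono_set
    Ioi_subset_Ici_self
  refine Asymptotics.IsBigO.of_bound 1 ?_
  filter_upwards [eventually_ge_atTop X, eventually_gt_atTop 0] with η hη hη0
  have h := (hX η hη τ ⟨le_rfl, by linarith⟩).le
  simp only [iterate_zero, id, pow_one] at h
  rw [Real.norm_of_nonneg (by positivity), Real.norm_of_nonneg (by positivity), one_mul,
    Real.rpow_neg hη0.le, Real.rpow_two, ← one_div, le_div_iff₀ (by positivity), ← mul_pow]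
  exact pow_le_one₀ (by positivity) (by rwa [mul_comm])

lemma tendsto_integral_trDensity (hG : IsAdmissibleTr G) {τ : ℝ} (hτ : 0 < τ) :
    Tendsto (fun R => ∫ x in (0:ℝ)..R, trDensity G (x, τ)) atTop
      (nhds ((∫ η in Ioi (-1/(6*τ^2)), ‖G η τ‖^2 : ℝ) : ℂ)) := by
  have h := (intervalIntegral_tendsto_integral_Ioi _ (hG.integrableOn_normSq hτ)
    (tendsto_atTop_add_const_right atTop (-1/(6*τ^2)) tendsto_id)).ofReal
  refine h.congr fun R => ?_
  have hx : ∀ x, trDensity G (x, τ) = ((‖G (x + -1/(6*τ^2)) τ‖^2 : ℝ) : ℂ) := fun x => by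
    rw [trDensity, trShift, Complex.star_def, Complex.conj_mul']
    push_cast
    rfl
  simp only [hx]
  rw [intervalIntegral.integral_ofReal,
    intervalIntegral.integral_comp_add_right (fun η => ‖G η τ‖^2), zero_add]
  rfl

lemma trNorm_eq_of_lt (hG : IsAdmissibleTr G)
    {s T : ℝ} (hs : 0 < s) (hsT : s < T) : trNorm G T = trNorm G s := by
  have h1 := (hG.tendsto_integral_trDensity (hs.trans hsT)).sub (hG.tendsto_integral_trDensity hs)
  have h2 := (hG.tendsto_integral_trFlux hs hsT).neg
  have h3 := tendsto_nhds_unique (h1.congr' ?_) h2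
  · rw [neg_zero, sub_eq_zero] at h3
    rw [trNorm, trNorm, Complex.ofReal_injective h3]
  · filter_upwards [eventually_gt_atTop 0] with R hR
    exact hG.integral_trDensity_sub hR hs hsT

lemma trNorm_eq (hG : IsAdmissibleTr G)
    {s t : ℝ} (hs : 0 < s) (ht : 0 < t) : trNorm G s = trNorm G t := by
  rcases lt_trichotomy s t with h | h | h
  · exact (hG.trNorm_eq_of_lt hs h).symm
  · rw [h]
  · exact hG.trNorm_eq_of_lt ht h

end IsAdmissibleTr

/-- the L² norm of G(·,τ) over (-1/(6τ²), +∞) is the same constant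
C₀ ≥ 0 for all 0 < τ < τ₁. -/
theorem statement2 (G : ℝ → ℝ → ℂ) (hG : IsAdmissibleTr G) (τ₁ : ℝ) (hτ₁ : 0 < τ₁) :
    ∃ C₀ : ℝ, 0 ≤ C₀ ∧ ∀ τ : ℝ, 0 < τ → τ < τ₁ → trNorm G τ = C₀ := by
  exact ⟨trNorm G (τ₁/2), Real.sqrt_nonneg _, fun τ h0 _ => hG.trNorm_eq h0 (half_pos hτ₁)⟩
end
end

section
/- Let G be an admissible transformed solution and let τ₁ > 0. Then for all 0 < τ ≤ τ₁, the quantity ‖∂_η G(·,τ)‖(τ) := (∫_{−1/(6τ²)}^{+∞} |∂_η G(η,τ)|² dη)^{1/2} satisfies ‖∂_η G(·,τ)‖(τ) ≤ ‖∂_η G(·,τ₁)‖(τ₁); in particular sup_{0<τ<τ₁} ‖∂_η G(·,τ)‖(τ) is finite. -/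
open MeasureTheory Filter Set Function

noncomputable section

/-- The boundary curve `η = -1/(6τ²)`. -/
def bdry (τ : ℝ) : ℝ := -1 / (6 * τ ^ 2)

/-- The speed `1/(3τ³)` of the boundary curve. -/
def bdrySpeed (τ : ℝ) : ℝ := 1 / (3 * τ ^ 3)

/-- The closed-open quadrant onto which the domain is straightened. -/
def quadrant : Set (ℝ × ℝ) := Ici 0 ×ˢ Ioi 0

/-- `G` in the coordinates `(x, τ)` with `η = bdry τ + x`. -/
def straighten (G : ℝ → ℝ → ℂ) (p : ℝ × ℝ) : ℂ := G (bdry p.2 + p.1) p.2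

/-- First partial derivative of `straighten G`, one-sided on the boundary. -/
def straightX (G : ℝ → ℝ → ℂ) (p : ℝ × ℝ) : ℂ :=
  fderivWithin ℝ (straighten G) quadrant p (1, 0)

/-- Second partial derivative of `straighten G`. -/
def straightT (G : ℝ → ℝ → ℂ) (p : ℝ × ℝ) : ℂ :=
  fderivWithin ℝ (straighten G) quadrant p (0, 1)

lemma hasDerivAt_bdry {τ : ℝ} (hτ : 0 < τ) : HasDerivAt bdry (bdrySpeed τ) τ := by
  have h : HasDerivAt (fun t : ℝ => 6 * t ^ 2) (6 * (2 * τ)) τ := by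
    simpa using ((hasDerivAt_id τ).pow 2).const_mul (6 : ℝ)
  have h' := (hasDerivAt_const τ (-1 : ℝ)).fun_div h (by positivity)
  refine h'.congr_deriv ?_
  unfold bdrySpeed
  field_simp
  norm_num

lemma contDiffOn_bdry : ContDiffOn ℝ (⊤ : ℕ∞) bdry (Ioi 0) := by
  unfold bdry
  refine ContDiffOn.div contDiffOn_const (by fun_prop) fun x hx => ?_
  have : (0 : ℝ) < x := hx
  positivity

lemma uniqueDiffOn_quadrant : UniqueDiffOn ℝ quadrant :=
  (uniqueDiffOn_Ici 0).prod (uniqueDiffOn_Ioi 0)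

lemma quadrant_mem_nhds {p : ℝ × ℝ} (h₁ : 0 < p.1) (h₂ : 0 < p.2) : quadrant ∈ nhds p :=
  prod_mem_nhds (Ici_mem_nhds h₁) (Ioi_mem_nhds h₂)

lemma hasDerivAt_mk_left (x τ : ℝ) : HasDerivAt (fun y : ℝ => (y, τ)) (1, 0) x :=
  (hasDerivAt_id x).prodMk (hasDerivAt_const x τ)

lemma hasDerivAt_mk_right (x τ : ℝ) : HasDerivAt (fun s : ℝ => (x, s)) (0, 1) τ :=
  (hasDerivAt_const τ x).prodMk (hasDerivAt_id τ)

lemma DifferentiableAt.hasDerivAt_fst {E : Type*} [NormedAddCommGroup E] [NormedSpace ℝ E]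
    {f : ℝ × ℝ → E} {x τ : ℝ} (h : DifferentiableAt ℝ f (x, τ)) :
    HasDerivAt (fun y => f (y, τ)) (fderiv ℝ f (x, τ) (1, 0)) x :=
  h.hasFDerivAt.comp_hasDerivAt x (hasDerivAt_mk_left x τ)

lemma DifferentiableAt.hasDerivAt_snd {E : Type*} [NormedAddCommGroup E] [NormedSpace ℝ E]
    {f : ℝ × ℝ → E} {x τ : ℝ} (h : DifferentiableAt ℝ f (x, τ)) :
    HasDerivAt (fun s => f (x, s)) (fderiv ℝ f (x, τ) (0, 1)) τ :=
  h.hasFDerivAt.comp_hasDerivAt τ (hasDerivAt_mk_right x τ)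

section Straightened

variable {G : ℝ → ℝ → ℂ}

lemma IsAdmissibleTr.contDiffOn_straighten (hG : IsAdmissibleTr G) :
    ContDiffOn ℝ (⊤ : ℕ∞) (straighten G) quadrant := by
  have hφ : ContDiffOn ℝ (⊤ : ℕ∞) (fun p : ℝ × ℝ => (bdry p.2 + p.1, p.2)) quadrant := by
    refine ContDiffOn.prodMk (ContDiffOn.add ?_ contDiffOn_fst) contDiffOn_snd
    exact contDiffOn_bdry.comp contDiffOn_snd fun p hp => hp.2
  refine hG.smooth.comp hφ fun p hp => ⟨hp.2, ?_⟩
  have h : (0 : ℝ) ≤ p.1 := hp.1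
  simpa [bdry] using h

lemma IsAdmissibleTr.contDiffOn_fderivWithin (hG : IsAdmissibleTr G) :
    ContDiffOn ℝ (⊤ : ℕ∞) (fderivWithin ℝ (straighten G) quadrant) quadrant :=
  hG.contDiffOn_straighten.fderivWithin uniqueDiffOn_quadrant (by norm_cast)

lemma IsAdmissibleTr.contDiffOn_straightX (hG : IsAdmissibleTr G) :
    ContDiffOn ℝ (⊤ : ℕ∞) (straightX G) quadrant :=
  hG.contDiffOn_fderivWithin.clm_apply contDiffOn_const

lemma IsAdmissibleTr.contDiffOn_straightT (hG : IsAdmissibleTr G) :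
    ContDiffOn ℝ (⊤ : ℕ∞) (straightT G) quadrant :=
  hG.contDiffOn_fderivWithin.clm_apply contDiffOn_const

lemma IsAdmissibleTr.hasFDerivWithinAt_straighten (hG : IsAdmissibleTr G) {p : ℝ × ℝ}
    (hp : p ∈ quadrant) : HasFDerivWithinAt (straighten G)
      (fderivWithin ℝ (straighten G) quadrant p) quadrant p :=
  (hG.contDiffOn_straighten.differentiableOn (by simp) p hp).hasFDerivWithinAt

lemma IsAdmissibleTr.straightT_zero (hG : IsAdmissibleTr G) {τ : ℝ} (hτ : 0 < τ) :
    straightT G (0, τ) = 0 := by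
  have h := (hG.hasFDerivWithinAt_straighten (p := (0, τ)) ⟨self_mem_Ici, hτ⟩).comp_hasDerivAt τ
    (hasDerivAt_mk_right 0 τ) (mem_of_superset (Ioi_mem_nhds hτ) fun s hs => ⟨self_mem_Ici, hs⟩)
  refine h.unique ((hasDerivAt_const τ (0 : ℂ)).congr_of_eventuallyEq ?_)
  filter_upwards [Ioi_mem_nhds hτ] with s hs
  simpa [straighten, bdry] using hG.bc s hs

lemma IsAdmissibleTr.hasFDerivAt_straighten (hG : IsAdmissibleTr G) {p : ℝ × ℝ}
    (h₁ : 0 < p.1) (h₂ : 0 < p.2) : HasFDerivAt (straighten G)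
      (fderivWithin ℝ (straighten G) quadrant p) p :=
  (hG.hasFDerivWithinAt_straighten ⟨h₁.le, h₂⟩).hasFDerivAt (quadrant_mem_nhds h₁ h₂)

lemma IsAdmissibleTr.pdX_eq (hG : IsAdmissibleTr G) {x τ : ℝ} (hx : 0 < x) (hτ : 0 < τ) :
    pdX G (bdry τ + x) τ = straightX G (x, τ) := by
  have h := (hG.hasFDerivAt_straighten (p := (x, τ)) hx hτ).comp_hasDerivAt x
    (hasDerivAt_mk_left x τ)
  rw [pdX, ← deriv_comp_const_add]
  exact h.deriv

lemma IsAdmissibleTr.pdX_pdX_eq (hG : IsAdmissibleTr G) {x τ : ℝ} (hx : 0 < x) (hτ : 0 < τ) :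
    pdX (pdX G) (bdry τ + x) τ = deriv (fun y => straightX G (y, τ)) x := by
  rw [pdX, ← deriv_comp_const_add]
  refine Filter.EventuallyEq.deriv_eq ?_
  filter_upwards [Ioi_mem_nhds hx] with y hy
  exact hG.pdX_eq hy hτ

lemma IsAdmissibleTr.pdT_eq_s4 (hG : IsAdmissibleTr G) {x τ : ℝ} (hx : 0 < x) (hτ : 0 < τ) :
    pdT G (bdry τ + x) τ = straightT G (x, τ) - bdrySpeed τ * straightX G (x, τ) := by
  have hc : HasDerivAt (fun s => (bdry τ + x - bdry s, s)) (-bdrySpeed τ, (1 : ℝ)) τ :=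
    ((hasDerivAt_bdry hτ).const_sub _).prodMk (hasDerivAt_id τ)
  have h := HasFDerivAt.comp_hasDerivAt (f := fun s => (bdry τ + x - bdry s, s)) τ
    (by simpa using hG.hasFDerivAt_straighten (p := (x, τ)) hx hτ) hc
  have e : straighten G ∘ (fun s => (bdry τ + x - bdry s, s)) = fun s => G (bdry τ + x) s := by
    funext s
    simp [straighten]
  rw [e] at h
  rw [pdT, h.deriv, straightT, straightX]
  have : ((-bdrySpeed τ, 1) : ℝ × ℝ) = (0, 1) - bdrySpeed τ • (1, 0) := by simp
  rw [this, map_sub, map_smul, Complex.real_smul]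

lemma IsAdmissibleTr.straightT_eq (hG : IsAdmissibleTr G) {x τ : ℝ} (hx : 0 < x) (hτ : 0 < τ) :
    straightT G (x, τ) = -(Complex.I / 2) * deriv (fun y => straightX G (y, τ)) x
      + bdrySpeed τ * straightX G (x, τ) := by
  have h := hG.eqn (bdry τ + x) τ hτ (by simpa [bdry] using hx)
  rw [hG.pdX_pdX_eq hx hτ, hG.pdT_eq_s4 hx hτ] at h
  linear_combination (-Complex.I) * h
    + (straightT G (x, τ) - bdrySpeed τ * straightX G (x, τ)) * Complex.I_sq

lemma fderivWithin_straighten_eventuallyEq {p : ℝ × ℝ}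
    (h₁ : 0 < p.1) (h₂ : 0 < p.2) :
    fderivWithin ℝ (straighten G) quadrant =ᶠ[nhds p] fderiv ℝ (straighten G) := by
  filter_upwards [prod_mem_nhds (Ioi_mem_nhds h₁) (Ioi_mem_nhds h₂)] with q hq
  exact fderivWithin_of_mem_nhds (quadrant_mem_nhds hq.1 hq.2)

lemma IsAdmissibleTr.hasFDerivAt_apply (hG : IsAdmissibleTr G) {p : ℝ × ℝ}
    (h₁ : 0 < p.1) (h₂ : 0 < p.2) (v : ℝ × ℝ) :
    HasFDerivAt (fun q => fderivWithin ℝ (straighten G) quadrant q v)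
      ((fderiv ℝ (fderiv ℝ (straighten G)) p).flip v) p := by
  have hn := quadrant_mem_nhds h₁ h₂
  have hd := ((hG.contDiffOn_fderivWithin.contDiffAt hn).differentiableAt (by simp)).hasFDerivAt
  rw [(fderivWithin_straighten_eventuallyEq h₁ h₂).fderiv_eq] at hd
  exact (ContinuousLinearMap.apply ℝ ℂ v).hasFDerivAt.comp p hd

lemma IsAdmissibleTr.hasDerivAt_mixed (hG : IsAdmissibleTr G) {x τ : ℝ} (hx : 0 < x)
    (hτ : 0 < τ) : ∃ Q : ℂ, HasDerivAt (fun s => straightX G (x, s)) Q τ ∧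
      HasDerivAt (fun y => straightT G (y, τ)) Q x := by
  have hs := (hG.contDiffOn_straighten.contDiffAt
    (quadrant_mem_nhds (p := (x, τ)) hx hτ)).isSymmSndFDerivAt (by simp; norm_cast)
  refine ⟨_, (hG.hasFDerivAt_apply (p := (x, τ)) hx hτ (1, 0)).comp_hasDerivAt τ
    (hasDerivAt_mk_right x τ), ?_⟩
  have h := (hG.hasFDerivAt_apply (p := (x, τ)) hx hτ (0, 1)).comp_hasDerivAt x
    (hasDerivAt_mk_left x τ)
  refine h.congr_deriv ?_
  exact hs (1, 0) (0, 1)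

lemma IsAdmissibleTr.differentiableAt_straightX (hG : IsAdmissibleTr G) {p : ℝ × ℝ}
    (h₁ : 0 < p.1) (h₂ : 0 < p.2) : DifferentiableAt ℝ (straightX G) p :=
  (hG.contDiffOn_straightX.contDiffAt (quadrant_mem_nhds h₁ h₂)).differentiableAt (by simp)

lemma IsAdmissibleTr.differentiableAt_straightT (hG : IsAdmissibleTr G) {p : ℝ × ℝ}
    (h₁ : 0 < p.1) (h₂ : 0 < p.2) : DifferentiableAt ℝ (straightT G) p :=
  (hG.contDiffOn_straightT.contDiffAt (quadrant_mem_nhds h₁ h₂)).differentiableAt (by simp)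

/-- The flux balancing the density `‖∂ₓH‖²` for the straightened solution `H`. -/
def flux (G : ℝ → ℝ → ℂ) (p : ℝ × ℝ) : ℝ :=
  bdrySpeed p.2 * ‖straightX G p‖ ^ 2 - 2 * inner ℝ (straightX G p) (straightT G p)

lemma IsAdmissibleTr.continuousOn_flux (hG : IsAdmissibleTr G) :
    ContinuousOn (flux G) quadrant := by
  have h₁ := hG.contDiffOn_straightX.continuousOn
  have h₂ := hG.contDiffOn_straightT.continuousOn
  have hb : ContinuousOn (fun p : ℝ × ℝ => bdrySpeed p.2) quadrant := by
    unfold bdrySpeed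
    refine ContinuousOn.div (by fun_prop) (by fun_prop) fun p hp => ?_
    have : 0 < p.2 := hp.2
    positivity
  exact (hb.mul (h₁.norm.pow 2)).sub (continuousOn_const.mul (h₁.inner h₂))

lemma IsAdmissibleTr.differentiableAt_flux (hG : IsAdmissibleTr G) {p : ℝ × ℝ}
    (h₁ : 0 < p.1) (h₂ : 0 < p.2) : DifferentiableAt ℝ (flux G) p := by
  have hX := hG.differentiableAt_straightX h₁ h₂
  have hT := hG.differentiableAt_straightT h₁ h₂
  have hb : DifferentiableAt ℝ (fun p : ℝ × ℝ => bdrySpeed p.2) p := by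
    unfold bdrySpeed
    have h : 3 * p.2 ^ 3 ≠ 0 := by positivity
    fun_prop (disch := assumption)
  exact (hb.fun_mul (hX.norm_sq ℝ)).fun_sub ((hX.inner ℝ hT).const_mul 2)

lemma IsAdmissibleTr.divergence_eq_zero (hG : IsAdmissibleTr G) {x τ : ℝ} (hx : 0 < x)
    (hτ : 0 < τ) : fderiv ℝ (flux G) (x, τ) (1, 0)
      + fderiv ℝ (fun p => ‖straightX G p‖ ^ 2) (x, τ) (0, 1) = 0 := by
  have hX := hG.differentiableAt_straightX (p := (x, τ)) hx hτ
  obtain ⟨Q, hQ₁, hQ₂⟩ := hG.hasDerivAt_mixed hx hτ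
  have hP : HasDerivAt (fun y => straightX G (y, τ)) (deriv (fun y => straightX G (y, τ)) x) x :=
    hX.hasDerivAt_fst.differentiableAt.hasDerivAt
  have e₁ := (hG.differentiableAt_flux (p := (x, τ)) hx hτ).hasDerivAt_fst.unique
    ((hP.norm_sq.const_mul (bdrySpeed τ)).fun_sub ((hP.inner ℝ hQ₂).const_mul 2))
  have e₂ := (hX.norm_sq ℝ).hasDerivAt_snd.unique hQ₁.norm_sq
  rw [e₁, e₂, hG.straightT_eq hx hτ]
  generalize deriv (fun y => straightX G (y, τ)) x = D
  generalize straightX G (x, τ) = P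
  simp only [Complex.inner, Complex.mul_re, Complex.mul_im, Complex.add_re, Complex.add_im,
    Complex.conj_re, Complex.conj_im, Complex.neg_re, Complex.neg_im, Complex.div_re,
    Complex.div_im, Complex.I_re, Complex.I_im, Complex.ofReal_re, Complex.ofReal_im]
  norm_num
  ring

lemma IsAdmissibleTr.energy_balance (hG : IsAdmissibleTr G) {τ₀ τ₁ N : ℝ} (h₀ : 0 < τ₀)
    (h₁ : τ₀ ≤ τ₁) (hN : 0 ≤ N) :
    (∫ x in (0 : ℝ)..N, ‖straightX G (x, τ₁)‖ ^ 2)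
      - (∫ x in (0 : ℝ)..N, ‖straightX G (x, τ₀)‖ ^ 2)
      = (∫ τ in τ₀..τ₁, flux G (0, τ)) - ∫ τ in τ₀..τ₁, flux G (N, τ) := by
  have hsub : uIcc 0 N ×ˢ uIcc τ₀ τ₁ ⊆ quadrant := by
    rw [uIcc_of_le hN, uIcc_of_le h₁]
    exact prod_mono Icc_subset_Ici_self fun s hs => h₀.trans_le hs.1
  have hint : ∀ p ∈ Ioo (min 0 N) (max 0 N) ×ˢ Ioo (min τ₀ τ₁) (max τ₀ τ₁),
      0 < p.1 ∧ 0 < p.2 := by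
    rw [min_eq_left hN, min_eq_left h₁]
    exact fun p hp => ⟨hp.1.1, h₀.trans hp.2.1⟩
  have hzero : EqOn (fun p : ℝ × ℝ => fderiv ℝ (flux G) p (1, 0)
      + fderiv ℝ (fun p => ‖straightX G p‖ ^ 2) p (0, 1)) 0 (Ioc 0 N ×ˢ Ioc τ₀ τ₁) :=
    fun p hp => hG.divergence_eq_zero hp.1.1 (h₀.trans hp.2.1)
  have key := integral2_divergence_prod_of_hasFDerivAt_off_countable (flux G)
    (fun p => ‖straightX G p‖ ^ 2) (fderiv ℝ (flux G))
    (fderiv ℝ (fun p => ‖straightX G p‖ ^ 2)) 0 τ₀ N τ₁ ∅ countable_empty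
    (hG.continuousOn_flux.mono hsub)
    ((hG.contDiffOn_straightX.continuousOn.mono hsub).norm.pow 2)
    (fun p hp => (hG.differentiableAt_flux (hint p hp.1).1 (hint p hp.1).2).hasFDerivAt)
    (fun p hp => ((hG.differentiableAt_straightX (hint p hp.1).1
      (hint p hp.1).2).norm_sq ℝ).hasFDerivAt) (by
      rw [uIcc_of_le hN, uIcc_of_le h₁]
      have hae : (Icc 0 N ×ˢ Icc τ₀ τ₁ : Set (ℝ × ℝ)) =ᵐ[volume] Ioc 0 N ×ˢ Ioc τ₀ τ₁ :=
        Measure.set_prod_ae_eq Ioc_ae_eq_Icc.symm Ioc_ae_eq_Icc.symm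
      rw [integrableOn_congr_set_ae hae,
        integrableOn_congr_fun hzero (measurableSet_Ioc.prod measurableSet_Ioc)]
      exact integrableOn_zero)
  have hlhs : (∫ x in (0 : ℝ)..N, ∫ τ in τ₀..τ₁, fderiv ℝ (flux G) (x, τ) (1, 0)
      + fderiv ℝ (fun p => ‖straightX G p‖ ^ 2) (x, τ) (0, 1)) = 0 := by
    refine intervalIntegral.integral_zero_ae (.of_forall fun x hx => ?_)
    refine intervalIntegral.integral_zero_ae (.of_forall fun τ hτ => ?_)
    rw [uIoc_of_le hN] at hx
    rw [uIoc_of_le h₁] at hτ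
    exact hG.divergence_eq_zero hx.1 (h₀.trans hτ.1)
  rw [hlhs] at key
  linarith

lemma bdrySpeed_nonneg {τ : ℝ} (hτ : 0 < τ) : 0 ≤ bdrySpeed τ := by
  unfold bdrySpeed
  positivity

lemma IsAdmissibleTr.flux_zero_nonneg (hG : IsAdmissibleTr G) {τ : ℝ} (hτ : 0 < τ) :
    0 ≤ flux G (0, τ) := by
  rw [flux, hG.straightT_zero hτ, inner_zero_right]
  have := bdrySpeed_nonneg hτ
  simp only [mul_zero, sub_zero]
  positivity

lemma IsAdmissibleTr.flux_le (hG : IsAdmissibleTr G) {x τ : ℝ} (hx : 0 < x) (hτ : 0 < τ) :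
    flux G (x, τ) ≤ 2 * (‖pdX G (bdry τ + x) τ‖ * ‖pdT G (bdry τ + x) τ‖) := by
  have hT : straightT G (x, τ)
      = pdT G (bdry τ + x) τ + (bdrySpeed τ) • pdX G (bdry τ + x) τ := by
    rw [hG.pdT_eq_s4 hx hτ, hG.pdX_eq hx hτ, Complex.real_smul]
    ring
  rw [flux, hT, ← hG.pdX_eq hx hτ, inner_add_right, inner_smul_right,
    real_inner_self_eq_norm_sq]
  have h := neg_le_of_abs_le (abs_real_inner_le_norm (pdX G (bdry τ + x) τ)
    (pdT G (bdry τ + x) τ))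
  have := mul_nonneg (bdrySpeed_nonneg hτ) (sq_nonneg ‖pdX G (bdry τ + x) τ‖)
  dsimp only
  linarith

lemma IsAdmissibleTr.exists_flux_le (hG : IsAdmissibleTr G) {τ₀ τ₁ : ℝ} (h₀ : 0 < τ₀)
    (h₁ : τ₀ < τ₁) {ε : ℝ} (hε : 0 < ε) :
    ∃ X > 0, ∀ x ≥ X, ∀ τ ∈ Icc τ₀ τ₁, flux G (x, τ) ≤ 2 * ε := by
  obtain ⟨X₁, hX₁⟩ := hG.decay 0 0 1 τ₀ τ₁ h₀ h₁ 1 one_pos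
  obtain ⟨X₂, hX₂⟩ := hG.decay 0 1 0 τ₀ τ₁ h₀ h₁ ε hε
  refine ⟨max 1 (max X₁ X₂ - bdry τ₀), by positivity, fun x hx τ hτ => ?_⟩
  have hτ' : 0 < τ := h₀.trans_le hτ.1
  have hb : bdry τ₀ ≤ bdry τ := by
    unfold bdry
    rw [neg_div, neg_div, neg_le_neg_iff]
    have := hτ.1
    gcongr
  have hx' : max X₁ X₂ ≤ bdry τ + x := by
    have := (le_max_right _ _).trans hx
    linarith
  have hx0 : 0 < x := one_pos.trans_le ((le_max_left _ _).trans hx)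
  have k₁ := hX₁ _ ((le_max_left _ _).trans hx') τ hτ
  have k₂ := hX₂ _ ((le_max_right _ _).trans hx') τ hτ
  simp only [pow_zero, one_mul, iterate_zero, iterate_one, id_eq] at k₁ k₂
  refine (hG.flux_le hx0 hτ').trans ?_
  have := mul_le_mul k₁.le k₂.le (norm_nonneg _) zero_le_one
  linarith

lemma IsAdmissibleTr.integrableOn_straightX (hG : IsAdmissibleTr G) {τ : ℝ} (hτ : 0 < τ) :
    IntegrableOn (fun x => ‖straightX G (x, τ)‖ ^ 2) (Ioi 0) := by
  have hc : ContinuousOn (fun x => ‖straightX G (x, τ)‖ ^ 2) (Ici 0) :=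
    ((hG.contDiffOn_straightX.continuousOn.comp (by fun_prop)
      (fun x hx => ⟨hx, hτ⟩ : MapsTo (fun x : ℝ => (x, τ)) (Ici 0) quadrant)).norm).pow 2
  obtain ⟨X, hX⟩ := hG.decay 1 0 1 (τ / 2) τ (by linarith) (by linarith) 1 one_pos
  set Y := max 1 (max X 1 - bdry τ) with hY
  have hY0 : 0 < Y := by positivity
  rw [← Ioc_union_Ioi_eq_Ioi hY0.le]
  refine IntegrableOn.union ?_ ?_
  · exact ((hc.mono Icc_subset_Ici_self).integrableOn_Icc).mono_set Ioc_subset_Icc_self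
  · have hpos : 0 < bdry τ + Y := by
      have h₁ : max X 1 - bdry τ ≤ Y := le_max_right _ _
      have h₂ : 1 ≤ max X 1 := le_max_right _ _
      linarith
    have hg : IntegrableOn (fun x : ℝ => (bdry τ + x) ^ (-2 : ℝ)) (Ioi Y) := by
      have h := (((measurePreserving_add_left volume (bdry τ)).integrableOn_comp_preimage
        (MeasurableEquiv.addLeft (bdry τ)).measurableEmbedding).2
        (integrableOn_Ioi_rpow_of_lt (a := -2) (by norm_num) hpos))
      simpa [Function.comp_def] using h
    refine Integrable.mono' hg ((hc.mono fun x hx => (hY0.trans hx).le).aestronglyMeasurable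
      measurableSet_Ioi) ?_
    refine (ae_restrict_iff' measurableSet_Ioi).2 (.of_forall fun x hx => ?_)
    have hx' : Y < x := hx
    have hη : 0 < bdry τ + x := by linarith
    have hη' : X ≤ bdry τ + x := by
      have h₁ : max X 1 - bdry τ ≤ Y := le_max_right _ _
      have h₂ : X ≤ max X 1 := le_max_left _ _
      linarith
    have k := hX _ hη' τ ⟨by linarith, le_rfl⟩
    simp only [pow_one, iterate_zero, iterate_one, id_eq] at k
    rw [hG.pdX_eq (hY0.trans hx') hτ] at k
    rw [Real.norm_of_nonneg (by positivity), Real.rpow_neg hη.le, Real.rpow_two,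
      ← one_div, le_div_iff₀ (by positivity)]
    have := pow_le_one₀ (n := 2) (by positivity) k.le
    linarith [mul_pow (bdry τ + x) ‖straightX G (x, τ)‖ 2]

lemma IsAdmissibleTr.trNorm_pdX (hG : IsAdmissibleTr G) {τ : ℝ} (hτ : 0 < τ) :
    trNorm (pdX G) τ = Real.sqrt (∫ x in Ioi (0 : ℝ), ‖straightX G (x, τ)‖ ^ 2) := by
  have h := (measurePreserving_add_left volume (bdry τ)).setIntegral_preimage_emb
    (MeasurableEquiv.addLeft (bdry τ)).measurableEmbedding
    (fun η => ‖pdX G η τ‖ ^ 2) (Ioi (bdry τ))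
  have hp : (fun x => bdry τ + x) ⁻¹' Ioi (bdry τ) = Ioi 0 := by
    ext x
    simp
  rw [hp] at h
  rw [trNorm]
  congr 1
  refine h.symm.trans (setIntegral_congr_fun measurableSet_Ioi fun x hx => ?_)
  simp only [hG.pdX_eq hx hτ]

lemma IsAdmissibleTr.energy_mono (hG : IsAdmissibleTr G) {τ₀ τ₁ : ℝ} (h₀ : 0 < τ₀)
    (h₁ : τ₀ < τ₁) : (∫ x in Ioi (0 : ℝ), ‖straightX G (x, τ₀)‖ ^ 2)
      ≤ ∫ x in Ioi (0 : ℝ), ‖straightX G (x, τ₁)‖ ^ 2 := by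
  have t₀ := intervalIntegral_tendsto_integral_Ioi 0 (hG.integrableOn_straightX h₀) tendsto_id
  have t₁ := intervalIntegral_tendsto_integral_Ioi 0
    (hG.integrableOn_straightX (h₀.trans h₁)) tendsto_id
  refine le_of_forall_pos_le_add fun ε hε => ?_
  obtain ⟨X, hX0, hX⟩ := hG.exists_flux_le h₀ h₁ (ε := ε / (2 * (τ₁ - τ₀)))
    (div_pos hε (by linarith))
  refine le_of_tendsto_of_tendsto t₀ (t₁.add_const ε) ?_
  filter_upwards [eventually_ge_atTop X] with N hN
  have hN0 : 0 < N := hX0.trans_le hN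
  have hbal := hG.energy_balance h₀ h₁.le hN0.le
  have hleft : 0 ≤ ∫ τ in τ₀..τ₁, flux G (0, τ) :=
    intervalIntegral.integral_nonneg h₁.le fun τ hτ => hG.flux_zero_nonneg (h₀.trans_le hτ.1)
  have hcont : ContinuousOn (fun τ => flux G (N, τ)) (uIcc τ₀ τ₁) := by
    refine hG.continuousOn_flux.comp (by fun_prop) fun τ hτ => ⟨hN0.le, ?_⟩
    rw [uIcc_of_le h₁.le] at hτ
    exact h₀.trans_le hτ.1
  have hright := intervalIntegral.integral_mono_on h₁.le hcont.intervalIntegrable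
    (_root_.intervalIntegrable_const (μ := volume) (c := 2 * (ε / (2 * (τ₁ - τ₀))))) (hX N hN)
  rw [intervalIntegral.integral_const, smul_eq_mul] at hright
  have hne : τ₁ - τ₀ ≠ 0 := by linarith
  have : (τ₁ - τ₀) * (2 * (ε / (2 * (τ₁ - τ₀)))) = ε := by
    field_simp
  simp only [id_eq]
  linarith

end Straightened

/-- for 0 < τ ≤ τ₁, ‖∂_η G(·,τ)‖(τ) ≤ ‖∂_η G(·,τ₁)‖(τ₁); in particular
sup over 0 < τ < τ₁ of ‖∂_η G(·,τ)‖(τ) is finite. -/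
theorem statement4 (G : ℝ → ℝ → ℂ) (hG : IsAdmissibleTr G) (τ₁ : ℝ) (hτ₁ : 0 < τ₁) :
    (∀ τ : ℝ, 0 < τ → τ ≤ τ₁ → trNorm (pdX G) τ ≤ trNorm (pdX G) τ₁) ∧
    BddAbove ((fun τ => trNorm (pdX G) τ) '' Set.Ioo 0 τ₁) := by
  have hmono : ∀ τ : ℝ, 0 < τ → τ ≤ τ₁ → trNorm (pdX G) τ ≤ trNorm (pdX G) τ₁ := by
    intro τ hτ hle
    rcases hle.eq_or_lt with rfl | hlt
    · exact le_rfl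
    · rw [hG.trNorm_pdX hτ, hG.trNorm_pdX hτ₁]
      exact Real.sqrt_le_sqrt (hG.energy_mono hτ hlt)
  refine ⟨hmono, trNorm (pdX G) τ₁, ?_⟩
  rintro _ ⟨τ, hτ, rfl⟩
  exact hmono τ hτ.1 hτ.2.le
end
end

section
/- Let G be an admissible transformed solution. Then for every τ > 0, d/dτ ( ∫_{−1/(6τ²)}^{+∞} η² |G(η,τ)|² dη ) = i ∫_{−1/(6τ²)}^{+∞} ( η · conj(G) · ∂_η G − η · G · conj(∂_η G) ) dη, and consequently the function I(τ) := ( ∫_{−1/(6τ²)}^{+∞} η² |G(η,τ)|² dη )^{1/2} satisfies |I′(τ)| ≤ ‖∂_η G(·,τ)‖(τ) wherever I(τ) ≠ 0. -/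
open MeasureTheory Filter Set Function

noncomputable section

/-- The weighted L² norm I(τ) = ‖η G(·,τ)‖(τ) over (-1/(6τ²), +∞). -/
def trNormW (G : ℝ → ℝ → ℂ) (τ : ℝ) : ℝ :=
  Real.sqrt (∫ η in Set.Ioi (-1/(6*τ^2)), η^2 * ‖G η τ‖^2)

/-- The Cauchy–Schwarz inequality for real integrals. -/
theorem sq_integral_mul_le {α : Type*} [MeasurableSpace α] {μ : Measure α} {f g : α → ℝ}
    (hff : Integrable (fun x => f x ^ 2) μ) (hgg : Integrable (fun x => g x ^ 2) μ)
    (hfg : Integrable (fun x => f x * g x) μ) :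
    (∫ x, f x * g x ∂μ) ^ 2 ≤ (∫ x, f x ^ 2 ∂μ) * ∫ x, g x ^ 2 ∂μ := by
  have h (t : ℝ) : 0 ≤ (∫ x, f x ^ 2 ∂μ) * (t * t) + (2 * ∫ x, f x * g x ∂μ) * t
      + ∫ x, g x ^ 2 ∂μ := by
    calc 0 ≤ ∫ x, (t * f x + g x) ^ 2 ∂μ := integral_nonneg fun x => sq_nonneg _
      _ = ∫ x, (t * t) * f x ^ 2 + (2 * t) * (f x * g x) + g x ^ 2 ∂μ := by
        congr 1 with x; ring
      _ = _ := by
        rw [integral_add (f := fun x => (t * t) * f x ^ 2 + (2 * t) * (f x * g x))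
            ((hff.const_mul _).add (hfg.const_mul _)) hgg,
          integral_add (hff.const_mul _) (hfg.const_mul _), integral_const_mul,
          integral_const_mul]
        ring
  have := discrim_le_zero h
  rw [discrim] at this
  nlinarith

/-- Translation of an integral over a half-line. -/
theorem integral_Ioi_eq_integral_Ioi_zero {E : Type*} [NormedAddCommGroup E] [NormedSpace ℝ E]
    (f : ℝ → E) (c : ℝ) : ∫ x in Ioi c, f x = ∫ y in Ioi (0 : ℝ), f (y + c) := by
  have h := (measurePreserving_add_right volume c).setIntegral_preimage_emb
    (measurableEmbedding_addRight c) f (Ioi c)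
  rw [← h]
  simp

/-- A smooth function on `[0, ∞) × (0, ∞)` has a smooth derivative in its first variable. -/
theorem ContDiffOn.exists_hasDerivAt_fst {H : ℝ × ℝ → ℂ}
    (hH : ContDiffOn ℝ (⊤ : ℕ∞) H (Ici 0 ×ˢ Ioi 0)) :
    ∃ K : ℝ × ℝ → ℂ, ContDiffOn ℝ (⊤ : ℕ∞) K (Ici 0 ×ˢ Ioi 0) ∧
      ∀ y t : ℝ, 0 < y → 0 < t → HasDerivAt (fun z => H (z, t)) (K (y, t)) y := by
  have hu : UniqueDiffOn ℝ (Ici (0 : ℝ) ×ˢ Ioi (0 : ℝ)) :=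
    (uniqueDiffOn_Ici 0).prod (uniqueDiffOn_Ioi 0)
  refine ⟨fun p => fderivWithin ℝ H (Ici 0 ×ˢ Ioi 0) p (1, 0), ?_, fun y t hy ht => ?_⟩
  · exact (hH.fderivWithin hu (by simp)).clm_apply contDiffOn_const
  · have hn : Ici (0 : ℝ) ×ˢ Ioi (0 : ℝ) ∈ nhds (y, t) := prod_mem_nhds (Ici_mem_nhds hy)
      (Ioi_mem_nhds ht)
    have hd : HasFDerivAt H (fderivWithin ℝ H (Ici 0 ×ˢ Ioi 0) (y, t)) (y, t) :=
      ((hH.differentiableOn (by simp)) (y, t) ⟨hy.le, ht⟩).hasFDerivWithinAt.hasFDerivAt hn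
    exact HasFDerivAt.comp_hasDerivAt y hd ((hasDerivAt_id y).prodMk (hasDerivAt_const y t))

theorem abs_mul_mul_le_of_le_inv {x M C e p q : ℝ} (hx : |x| * e ≤ M) (hC : 0 ≤ C)
    (he : 0 ≤ e) (hp : |p| ≤ C * e) (hq : |q| ≤ C * e) : |x * (p * q)| ≤ M * C ^ 2 * e := by
  rw [abs_mul, abs_mul]
  calc |x| * (|p| * |q|) ≤ |x| * ((C * e) * (C * e)) := by gcongr
    _ = (|x| * e) * (C ^ 2 * e) := by ring
    _ ≤ M * (C ^ 2 * e) := by gcongr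
    _ = _ := by ring

theorem abs_add_mul_inv_le {y b B : ℝ} (hb : |b| ≤ B) :
    |y + b| * (1 + y ^ 2)⁻¹ ≤ 2 * (1 + B) ^ 2 ∧
      |(y + b) ^ 2| * (1 + y ^ 2)⁻¹ ≤ 2 * (1 + B) ^ 2 := by
  have hw : 0 < 1 + y ^ 2 := by positivity
  have hB : 0 ≤ B := (abs_nonneg b).trans hb
  have hb2 : b ^ 2 ≤ B ^ 2 := sq_le_sq' (by linarith [abs_le.1 hb]) (abs_le.1 hb).2
  have key : (1 + y ^ 2) + 2 * B ^ 2 * (1 + y ^ 2) ≤ 2 * (1 + B) ^ 2 * (1 + y ^ 2) := by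
    have : 1 + 2 * B ^ 2 ≤ 2 * (1 + B) ^ 2 := by nlinarith
    nlinarith
  rw [← div_eq_mul_inv, ← div_eq_mul_inv, div_le_iff₀ hw, div_le_iff₀ hw]
  constructor
  · have h1 : |y + b| ≤ |y| + B := (abs_add_le y b).trans (by linarith)
    have h2 : |y| ≤ 1 + y ^ 2 := by nlinarith [sq_abs y, sq_nonneg (|y| - 1), abs_nonneg y]
    nlinarith [sq_nonneg y, mul_nonneg hB (sq_nonneg y)]
  · rw [abs_of_nonneg (sq_nonneg _)]
    nlinarith [sq_nonneg (y - b), sq_nonneg y, mul_nonneg hB (sq_nonneg y),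
      mul_nonneg (mul_nonneg hB hB) (sq_nonneg y)]

theorem integrableOn_Ioi_of_le_inv {f : ℝ → ℝ} {K : ℝ} (hf : ContinuousOn f (Ioi 0))
    (hK : ∀ y : ℝ, 0 < y → |f y| ≤ K * (1 + y ^ 2)⁻¹) : IntegrableOn f (Ioi 0) :=
  (integrable_inv_one_add_sq.integrableOn.const_mul K).mono'
    (hf.aestronglyMeasurable measurableSet_Ioi)
    ((ae_restrict_iff' measurableSet_Ioi).2 (Eventually.of_forall hK))

theorem tendsto_zero_of_le_inv {f : ℝ → ℝ} {K : ℝ}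
    (hK : ∀ y : ℝ, 0 < y → |f y| ≤ K * (1 + y ^ 2)⁻¹) : Tendsto f atTop (nhds 0) := by
  refine squeeze_zero_norm' ((eventually_gt_atTop 0).mono hK) ?_
  have h : Tendsto (fun y : ℝ => (1 + y ^ 2)⁻¹) atTop (nhds 0) :=
    (tendsto_atTop_add_const_left _ 1 (tendsto_pow_atTop two_ne_zero)).inv_tendsto_atTop
  simpa using h.const_mul K

/-- A family of functions on `[0, ∞)`, continuous and uniformly `O((1 + y²)⁻¹)`. -/
def HasQuadraticDecay (s : Set ℝ) (C : ℝ) (u : ℝ → ℝ → ℝ) : Prop :=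
  ∀ σ ∈ s, ContinuousOn (u σ) (Ici 0) ∧ ∀ y : ℝ, 0 < y → |u σ y| ≤ C * (1 + y ^ 2)⁻¹

/-- The derivative of the weighted mass on a half-line, for `u₀ + i v₀` solving the Schrödinger
equation in coordinates moving with the endpoint `b`. -/
theorem hasDerivAt_weighted_mass {b b' : ℝ → ℝ} {u₀ u₁ u₂ v₀ v₁ v₂ : ℝ → ℝ → ℝ} {s : Set ℝ}
    {τ C B : ℝ} (hC : 0 ≤ C) (hs : s ∈ nhds τ) (hbB : ∀ σ ∈ s, |b σ| ≤ B)
    (hbB' : ∀ σ ∈ s, |b' σ| ≤ B) (hb : ∀ σ ∈ s, HasDerivAt b (b' σ) σ)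
    (hu₀ : HasQuadraticDecay s C u₀) (hu₁ : HasQuadraticDecay s C u₁)
    (hu₂ : HasQuadraticDecay s C u₂) (hv₀ : HasQuadraticDecay s C v₀)
    (hv₁ : HasQuadraticDecay s C v₁) (hv₂ : HasQuadraticDecay s C v₂)
    (hu₀y : ∀ σ ∈ s, ∀ y : ℝ, 0 < y → HasDerivAt (u₀ σ) (u₁ σ y) y)
    (hv₀y : ∀ σ ∈ s, ∀ y : ℝ, 0 < y → HasDerivAt (v₀ σ) (v₁ σ y) y)
    (hu₁y : ∀ σ ∈ s, ∀ y : ℝ, 0 < y → HasDerivAt (u₁ σ) (u₂ σ y) y)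
    (hv₁y : ∀ σ ∈ s, ∀ y : ℝ, 0 < y → HasDerivAt (v₁ σ) (v₂ σ y) y)
    (hu₀t : ∀ σ ∈ s, ∀ y : ℝ, 0 < y →
      HasDerivAt (fun r => u₀ r y) (b' σ * u₁ σ y + v₂ σ y / 2) σ)
    (hv₀t : ∀ σ ∈ s, ∀ y : ℝ, 0 < y →
      HasDerivAt (fun r => v₀ r y) (b' σ * v₁ σ y - u₂ σ y / 2) σ)
    (hu₀0 : u₀ τ 0 = 0) (hv₀0 : v₀ τ 0 = 0) :
    HasDerivAt (fun σ => ∫ y in Ioi (0 : ℝ), (y + b σ) ^ 2 * (u₀ σ y ^ 2 + v₀ σ y ^ 2))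
      (∫ y in Ioi (0 : ℝ), -2 * ((y + b τ) * (u₀ τ y * v₁ τ y - v₀ τ y * u₁ τ y))) τ := by
  have hτ : τ ∈ s := mem_of_mem_nhds hs
  have hB : 0 ≤ B := (abs_nonneg _).trans (hbB τ hτ)
  set M : ℝ := 2 * (1 + B) ^ 2 * C ^ 2 with hM
  have hM0 : 0 ≤ M := by positivity
  have hcont {u : ℝ → ℝ → ℝ} (hu : HasQuadraticDecay s C u) {σ : ℝ} (hσ : σ ∈ s) :
      ContinuousOn (u σ) (Ioi 0) := (hu σ hσ).1.mono Ioi_subset_Ici_self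
  have hlin {p q : ℝ → ℝ → ℝ} (hp : HasQuadraticDecay s C p) (hq : HasQuadraticDecay s C q)
      (σ : ℝ) (hσ : σ ∈ s) (y : ℝ) (hy : 0 < y) :
      |(y + b σ) * (p σ y * q σ y)| ≤ M * (1 + y ^ 2)⁻¹ :=
    abs_mul_mul_le_of_le_inv (abs_add_mul_inv_le (hbB σ hσ)).1 hC (by positivity)
      ((hp σ hσ).2 y hy) ((hq σ hσ).2 y hy)
  have hsq {p q : ℝ → ℝ → ℝ} (hp : HasQuadraticDecay s C p) (hq : HasQuadraticDecay s C q)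
      (σ : ℝ) (hσ : σ ∈ s) (y : ℝ) (hy : 0 < y) :
      |(y + b σ) ^ 2 * (p σ y * q σ y)| ≤ M * (1 + y ^ 2)⁻¹ :=
    abs_mul_mul_le_of_le_inv (abs_add_mul_inv_le (hbB σ hσ)).2 hC (by positivity)
      ((hp σ hσ).2 y hy) ((hq σ hσ).2 y hy)
  have hmul {c x K : ℝ} (hc : |c| ≤ B) (hx : |x| ≤ K) : |c * x| ≤ B * K := by
    rw [abs_mul]; gcongr
  let F (σ y : ℝ) : ℝ := (y + b σ) ^ 2 * (u₀ σ y ^ 2 + v₀ σ y ^ 2)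
  let F' (σ y : ℝ) : ℝ := 2 * (y + b σ) * b' σ * (u₀ σ y ^ 2 + v₀ σ y ^ 2)
    + (y + b σ) ^ 2 * (2 * u₀ σ y * (b' σ * u₁ σ y + v₂ σ y / 2)
      + 2 * v₀ σ y * (b' σ * v₁ σ y - u₂ σ y / 2))
  have hFcont (σ : ℝ) (hσ : σ ∈ s) : ContinuousOn (F σ) (Ioi 0) := by
    have h₀ := hcont hu₀ hσ
    have h₁ := hcont hv₀ hσ
    fun_prop
  have hF'cont (σ : ℝ) (hσ : σ ∈ s) : ContinuousOn (F' σ) (Ioi 0) := by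
    have h₀ := hcont hu₀ hσ
    have h₁ := hcont hv₀ hσ
    have h₂ := hcont hu₁ hσ
    have h₃ := hcont hv₁ hσ
    have h₄ := hcont hu₂ hσ
    have h₅ := hcont hv₂ hσ
    fun_prop
  have hFbound (σ : ℝ) (hσ : σ ∈ s) (y : ℝ) (hy : 0 < y) :
      |F σ y| ≤ (2 * M) * (1 + y ^ 2)⁻¹ := by
    have h₀ := abs_le.1 (hsq hu₀ hu₀ σ hσ y hy)
    have h₁ := abs_le.1 (hsq hv₀ hv₀ σ hσ y hy)
    simp only [F]
    rw [abs_le]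
    constructor <;> linarith
  have hF'bound (σ : ℝ) (hσ : σ ∈ s) (y : ℝ) (hy : 0 < y) :
      |F' σ y| ≤ (8 * B * M + 2 * M) * (1 + y ^ 2)⁻¹ := by
    have h₀ := abs_le.1 (hmul (hbB' σ hσ) (hlin hu₀ hu₀ σ hσ y hy))
    have h₁ := abs_le.1 (hmul (hbB' σ hσ) (hlin hv₀ hv₀ σ hσ y hy))
    have h₂ := abs_le.1 (hmul (hbB' σ hσ) (hsq hu₀ hu₁ σ hσ y hy))
    have h₃ := abs_le.1 (hmul (hbB' σ hσ) (hsq hv₀ hv₁ σ hσ y hy))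
    have h₄ := abs_le.1 (hsq hu₀ hv₂ σ hσ y hy)
    have h₅ := abs_le.1 (hsq hv₀ hu₂ σ hσ y hy)
    have : F' σ y = 2 * (b' σ * ((y + b σ) * (u₀ σ y * u₀ σ y)))
      + 2 * (b' σ * ((y + b σ) * (v₀ σ y * v₀ σ y)))
      + 2 * (b' σ * ((y + b σ) ^ 2 * (u₀ σ y * u₁ σ y)))
      + 2 * (b' σ * ((y + b σ) ^ 2 * (v₀ σ y * v₁ σ y)))
      + (y + b σ) ^ 2 * (u₀ σ y * v₂ σ y) - (y + b σ) ^ 2 * (v₀ σ y * u₂ σ y) := by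
      simp only [F']; ring
    rw [this, abs_le]
    constructor <;> linarith
  have hderiv := (hasDerivAt_integral_of_dominated_loc_of_deriv_le
    (μ := volume.restrict (Ioi (0 : ℝ))) (F := F) (F' := F') hs
    (eventually_of_mem hs fun σ hσ => (hFcont σ hσ).aestronglyMeasurable measurableSet_Ioi)
    (integrableOn_Ioi_of_le_inv (hFcont τ hτ) (hFbound τ hτ))
    ((hF'cont τ hτ).aestronglyMeasurable measurableSet_Ioi)
    ((ae_restrict_iff' measurableSet_Ioi).2 (Eventually.of_forall fun y hy σ hσ =>
      hF'bound σ hσ y hy))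
    (integrable_inv_one_add_sq.integrableOn.const_mul _)
    ((ae_restrict_iff' measurableSet_Ioi).2 (Eventually.of_forall fun y hy σ hσ => by
      have h := (((hb σ hσ).const_add y).pow 2).mul
        (((hu₀t σ hσ y hy).pow 2).add ((hv₀t σ hσ y hy).pow 2))
      convert! h using 1
      simp [F'])))
  obtain ⟨hF'int, hderiv⟩ := hderiv
  let Φ (y : ℝ) : ℝ := b' τ * ((y + b τ) ^ 2 * (u₀ τ y ^ 2 + v₀ τ y ^ 2))
    + (y + b τ) ^ 2 * (u₀ τ y * v₁ τ y - v₀ τ y * u₁ τ y)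
  let R (y : ℝ) : ℝ := -2 * ((y + b τ) * (u₀ τ y * v₁ τ y - v₀ τ y * u₁ τ y))
  have hRint : IntegrableOn R (Ioi 0) := by
    refine integrableOn_Ioi_of_le_inv (K := 4 * M) ?_ fun y hy => ?_
    · have h₀ := hcont hu₀ hτ
      have h₁ := hcont hv₀ hτ
      have h₂ := hcont hu₁ hτ
      have h₃ := hcont hv₁ hτ
      fun_prop
    · have h₀ := abs_le.1 (hlin hu₀ hv₁ τ hτ y hy)
      have h₁ := abs_le.1 (hlin hv₀ hu₁ τ hτ y hy)
      simp only [R]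
      rw [abs_le]
      constructor <;> linarith
  have hΦ : ∫ y in Ioi (0 : ℝ), (F' τ y - R y) = 0 - Φ 0 := by
    refine integral_Ioi_of_hasDerivAt_of_tendsto ?_ (fun y hy => ?_) (hF'int.sub hRint) ?_
    · have h₀ := (hu₀ τ hτ).1 0 self_mem_Ici
      have h₁ := (hv₀ τ hτ).1 0 self_mem_Ici
      have h₂ := (hu₁ τ hτ).1 0 self_mem_Ici
      have h₃ := (hv₁ τ hτ).1 0 self_mem_Ici
      fun_prop
    · have h₁ := ((hasDerivAt_id y).add_const (b τ)).pow 2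
      have h₂ := ((hu₀y τ hτ y hy).pow 2).add ((hv₀y τ hτ y hy).pow 2)
      have h₃ := ((hu₀y τ hτ y hy).mul (hv₁y τ hτ y hy)).sub
        ((hv₀y τ hτ y hy).mul (hu₁y τ hτ y hy))
      convert! ((h₁.mul h₂).const_mul (b' τ)).add (h₁.mul h₃) using 1
      simp [F', R]
      ring
    · refine tendsto_zero_of_le_inv (K := 2 * B * M + 2 * M) fun y hy => ?_
      have h₀ := abs_le.1 (hmul (hbB' τ hτ) (hsq hu₀ hu₀ τ hτ y hy))
      have h₁ := abs_le.1 (hmul (hbB' τ hτ) (hsq hv₀ hv₀ τ hτ y hy))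
      have h₂ := abs_le.1 (hsq hu₀ hv₁ τ hτ y hy)
      have h₃ := abs_le.1 (hsq hv₀ hu₁ τ hτ y hy)
      simp only [Φ]
      rw [abs_le]
      constructor <;> linarith
  have hΦ0 : Φ 0 = 0 := by simp [Φ, hu₀0, hv₀0]
  rw [integral_sub hF'int hRint, hΦ0, sub_zero, sub_eq_zero] at hΦ
  rwa [hΦ] at hderiv

theorem hasDerivAt_neg_one_div_six_mul_sq {t : ℝ} (ht : 0 < t) :
    HasDerivAt (fun s : ℝ => -1 / (6 * s ^ 2)) (1 / (3 * t ^ 3)) t := by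
  have h := (hasDerivAt_const t (-1 : ℝ)).div (((hasDerivAt_id t).pow 2).const_mul 6)
    (by simp [ht.ne'])
  convert! h using 1
  simp
  field_simp
  norm_num

/-- Straightening of the boundary curve. -/
def flatten (G : ℝ → ℝ → ℂ) (p : ℝ × ℝ) : ℂ := G (p.1 + -1 / (6 * p.2 ^ 2)) p.2

theorem IsAdmissibleTr.contDiffOn_flatten {G : ℝ → ℝ → ℂ} (hG : IsAdmissibleTr G) :
    ContDiffOn ℝ (⊤ : ℕ∞) (flatten G) (Ici 0 ×ˢ Ioi 0) := by
  refine hG.smooth.comp (f := fun p : ℝ × ℝ => (p.1 + -1 / (6 * p.2 ^ 2), p.2)) ?_ ?_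
  · refine (contDiffOn_fst.add (contDiffOn_const.div ?_ ?_)).prodMk contDiffOn_snd
    · exact contDiffOn_const.mul (contDiffOn_snd.pow 2)
    · rintro p ⟨-, hp⟩
      have : 0 < p.2 := hp
      positivity
  · rintro p ⟨hp, hp'⟩
    exact ⟨hp', le_add_of_nonneg_left hp⟩

theorem deriv_fst_eq_of_flatten {G : ℝ → ℝ → ℂ} {c : ℂ} {y t : ℝ}
    (h : HasDerivAt (fun z => flatten G (z, t)) c y) :
    pdX G (y + -1 / (6 * t ^ 2)) t = c := by
  have h' := HasDerivAt.comp_sub_const (y + -1 / (6 * t ^ 2)) (-1 / (6 * t ^ 2))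
    (f := fun z => flatten G (z, t)) (f' := c) (by simpa using h)
  simp only [flatten, sub_add_cancel] at h'
  exact h'.deriv

/-- In straightened coordinates an admissible solution is smooth up to the boundary and solves
the Schrödinger equation with a drift. -/
theorem IsAdmissibleTr.exists_flatten_derivs {G : ℝ → ℝ → ℂ} (hG : IsAdmissibleTr G) :
    ∃ H₁ H₂ : ℝ × ℝ → ℂ, ContinuousOn H₁ (Ici 0 ×ˢ Ioi 0) ∧ ContinuousOn H₂ (Ici 0 ×ˢ Ioi 0) ∧
      ∀ y t : ℝ, 0 < y → 0 < t →
        HasDerivAt (fun z => flatten G (z, t)) (H₁ (y, t)) y ∧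
        HasDerivAt (fun z => H₁ (z, t)) (H₂ (y, t)) y ∧
        H₁ (y, t) = flatten (pdX G) (y, t) ∧ H₂ (y, t) = flatten (pdX (pdX G)) (y, t) ∧
        HasDerivAt (fun s => flatten G (y, s))
          ((1 / (3 * t ^ 3) : ℝ) * H₁ (y, t) - Complex.I / 2 * H₂ (y, t)) t := by
  obtain ⟨H₁, hc₁, hd₁⟩ := hG.contDiffOn_flatten.exists_hasDerivAt_fst
  obtain ⟨H₂, hc₂, hd₂⟩ := hc₁.exists_hasDerivAt_fst
  have e₁ (y t : ℝ) (hy : 0 < y) (ht : 0 < t) : H₁ (y, t) = flatten (pdX G) (y, t) :=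
    (deriv_fst_eq_of_flatten (hd₁ y t hy ht)).symm
  refine ⟨H₁, H₂, hc₁.continuousOn, hc₂.continuousOn, fun y t hy ht => ?_⟩
  have e₂ : H₂ (y, t) = flatten (pdX (pdX G)) (y, t) := by
    refine (deriv_fst_eq_of_flatten ((hd₂ y t hy ht).congr_of_eventuallyEq ?_)).symm
    filter_upwards [Ioi_mem_nhds hy] with z hz
    exact (e₁ z t hz ht).symm
  refine ⟨hd₁ y t hy ht, hd₂ y t hy ht, e₁ y t hy ht, e₂, ?_⟩
  obtain ⟨L, hL⟩ : DifferentiableAt ℝ (flatten G) (y, t) :=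
    ((hG.contDiffOn_flatten.differentiableOn (by simp)) (y, t) ⟨hy.le, ht⟩).differentiableAt
      (prod_mem_nhds (Ici_mem_nhds hy) (Ioi_mem_nhds ht))
  have hLy : HasDerivAt (fun z => flatten G (z, t)) (L (1, 0)) y :=
    HasFDerivAt.comp_hasDerivAt (f := fun z => (z, t)) y hL
      ((hasDerivAt_id y).prodMk (hasDerivAt_const y t))
  have hL₁ : L (1, 0) = H₁ (y, t) := hLy.unique (hd₁ y t hy ht)
  have hL₂ : HasDerivAt (fun s => flatten G (y, s)) (L (0, 1)) t :=
    HasFDerivAt.comp_hasDerivAt t hL ((hasDerivAt_const t y).prodMk (hasDerivAt_id t))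
  set η := y + -1 / (6 * t ^ 2) with hη
  have hpt : (η - -1 / (6 * t ^ 2), t) = (y, t) := by simp [hη]
  have hL₃ : HasDerivAt (fun s => G η s) (L (-(1 / (3 * t ^ 3)), 1)) t := by
    have h := HasFDerivAt.comp_hasDerivAt t (hpt ▸ hL)
      (((hasDerivAt_neg_one_div_six_mul_sq ht).const_sub η).prodMk (hasDerivAt_id t))
    refine h.congr_of_eventuallyEq (Eventually.of_forall fun s => ?_)
    simp [flatten]
  have hsplit : L (-(1 / (3 * t ^ 3)), 1) = -((1 / (3 * t ^ 3) : ℝ) * H₁ (y, t)) + L (0, 1) := by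
    have : ((-(1 / (3 * t ^ 3)), 1) : ℝ × ℝ) = -((1 / (3 * t ^ 3)) • ((1, 0) : ℝ × ℝ)) + (0, 1) := by
      simp
    rw [this, map_add, map_neg, map_smul, hL₁, Complex.real_smul]
  have heq := hG.eqn η t ht (by rw [hη]; linarith)
  have hT : pdT G η t = -((1 / (3 * t ^ 3) : ℝ) * H₁ (y, t)) + L (0, 1) := hL₃.deriv.trans hsplit
  have hXX : pdX (pdX G) η t = H₂ (y, t) := e₂.symm
  rw [hT, hXX] at heq
  convert! hL₂ using 1
  linear_combination Complex.I * heq -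
    (L (0, 1) - (1 / (3 * t ^ 3) : ℝ) * H₁ (y, t)) * Complex.I_sq

theorem abs_neg_one_div_six_mul_sq_le {δ σ : ℝ} (hδ : 0 < δ) (h : δ ≤ σ) :
    |-1 / (6 * σ ^ 2)| ≤ 1 / (6 * δ ^ 2) := by
  rw [abs_div, abs_neg, abs_one, abs_of_nonneg (by positivity)]
  gcongr

theorem exists_flatten_bound {g : ℝ → ℝ → ℂ} {K : ℝ × ℝ → ℂ}
    (hK : ContinuousOn K (Ici 0 ×ˢ Ioi 0))
    (hKg : ∀ y t : ℝ, 0 < y → 0 < t → K (y, t) = flatten g (y, t)) {δ τ₁ : ℝ} (hδ : 0 < δ)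
    (hg : ∀ (α : ℕ), ∃ X : ℝ, ∀ η ≥ X, ∀ τ ∈ Icc δ τ₁, η ^ α * ‖g η τ‖ < 1) :
    ∃ C : ℝ, 0 ≤ C ∧ ∀ σ ∈ Icc δ τ₁, ∀ y : ℝ, 0 < y → ‖K (y, σ)‖ ≤ C * (1 + y ^ 2)⁻¹ := by
  obtain ⟨X₀, hX₀⟩ := hg 0
  obtain ⟨X₂, hX₂⟩ := hg 2
  set B : ℝ := 1 / (6 * δ ^ 2)
  set Y : ℝ := max X₀ X₂ + B
  obtain ⟨C₀, hC₀⟩ := (isCompact_Icc.prod isCompact_Icc).exists_bound_of_continuousOn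
    (s := Icc 0 Y ×ˢ Icc δ τ₁) (hK.mono (prod_mono Icc_subset_Ici_self
      fun t ht => hδ.trans_le ht.1))
  refine ⟨|C₀| * (1 + Y ^ 2) + (3 + 2 * B ^ 2), by positivity, fun σ hσ y hy => ?_⟩
  rw [← div_eq_mul_inv, le_div_iff₀ (by positivity)]
  rcases le_or_gt y Y with h | h
  · have h₁ : ‖K (y, σ)‖ ≤ |C₀| := (hC₀ (y, σ) ⟨⟨hy.le, h⟩, hσ⟩).trans (le_abs_self _)
    calc ‖K (y, σ)‖ * (1 + y ^ 2) ≤ |C₀| * (1 + Y ^ 2) := by gcongr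
      _ ≤ _ := le_add_of_nonneg_right (by positivity)
  · have hb := abs_le.1 (abs_neg_one_div_six_mul_sq_le hδ hσ.1)
    set η := y + -1 / (6 * σ ^ 2) with hη
    have hηX : max X₀ X₂ ≤ η := by
      simp only [Y, B] at h
      linarith [hb.1]
    have h₀ := hX₀ η ((le_max_left _ _).trans hηX) σ hσ
    have h₂ := hX₂ η ((le_max_right _ _).trans hηX) σ hσ
    rw [hKg y σ hy (hδ.trans_le hσ.1)]
    change ‖g η σ‖ * (1 + y ^ 2) ≤ _
    have hy2 : y ^ 2 ≤ 2 * η ^ 2 + 2 * B ^ 2 := by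
      have : y = η - -1 / (6 * σ ^ 2) := by rw [hη]; ring
      have hb2 : (-1 / (6 * σ ^ 2)) ^ 2 ≤ B ^ 2 := sq_le_sq' hb.1 hb.2
      rw [this]
      nlinarith [sq_nonneg (η + -1 / (6 * σ ^ 2))]
    rw [pow_zero, one_mul] at h₀
    calc ‖g η σ‖ * (1 + y ^ 2) ≤ ‖g η σ‖ * (1 + (2 * η ^ 2 + 2 * B ^ 2)) := by gcongr
      _ = ‖g η σ‖ * (1 + 2 * B ^ 2) + 2 * (η ^ 2 * ‖g η σ‖) := by ring
      _ ≤ 1 * (1 + 2 * B ^ 2) + 2 * 1 := by gcongr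
      _ ≤ |C₀| * (1 + Y ^ 2) + (3 + 2 * B ^ 2) := by
        have : 0 ≤ |C₀| * (1 + Y ^ 2) := by positivity
        linarith

theorem norm_flatten_weight (G : ℝ → ℝ → ℂ) (σ y : ℝ) :
    (y + -1 / (6 * σ ^ 2)) ^ 2 * ‖G (y + -1 / (6 * σ ^ 2)) σ‖ ^ 2 =
      (y + -1 / (6 * σ ^ 2)) ^ 2 *
        ((flatten G (y, σ)).re ^ 2 + (flatten G (y, σ)).im ^ 2) := by
  rw [Complex.sq_norm, Complex.normSq_apply, flatten]
  ring

/-- The time derivative of the weighted mass, with the bound from the Cauchy–Schwarz inequality. -/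
theorem IsAdmissibleTr.hasDerivAt_weighted_mass {G : ℝ → ℝ → ℂ} (hG : IsAdmissibleTr G) {τ : ℝ}
    (hτ : 0 < τ) : ∃ D : ℝ,
      HasDerivAt (fun σ : ℝ => ∫ η in Ioi (-1 / (6 * σ ^ 2)), η ^ 2 * ‖G η σ‖ ^ 2) D τ ∧
      (D : ℂ) = Complex.I * ∫ η : ℝ in Ioi (-1 / (6 * τ ^ 2)),
        ((η : ℂ) * (starRingEnd ℂ) (G η τ) * pdX G η τ
          - (η : ℂ) * G η τ * (starRingEnd ℂ) (pdX G η τ)) ∧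
      |D| ≤ 2 * (trNormW G τ * trNorm (pdX G) τ) := by
  obtain ⟨H₁, H₂, hc₁, hc₂, hH⟩ := hG.exists_flatten_derivs
  have hc₀ := hG.contDiffOn_flatten.continuousOn
  set s := Icc (τ / 2) (2 * τ) with hs_def
  have hδ : 0 < τ / 2 := by positivity
  have hlt : τ / 2 < 2 * τ := by linarith
  have hs : s ∈ nhds τ := Icc_mem_nhds (by linarith) (by linarith)
  have hpos {σ : ℝ} (hσ : σ ∈ s) : 0 < σ := hδ.trans_le hσ.1
  have hτs : τ ∈ s := mem_of_mem_nhds hs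
  obtain ⟨C₀, hC₀, hb₀⟩ := exists_flatten_bound (g := G) (τ₁ := 2 * τ) hc₀
    (fun _ _ _ _ => rfl) hδ fun α => hG.decay α 0 0 _ _ hδ hlt 1 one_pos
  obtain ⟨C₁, hC₁, hb₁⟩ := exists_flatten_bound (g := pdX G) (τ₁ := 2 * τ) hc₁
    (fun y t hy ht => (hH y t hy ht).2.2.1) hδ fun α => hG.decay α 0 1 _ _ hδ hlt 1 one_pos
  obtain ⟨C₂, hC₂, hb₂⟩ := exists_flatten_bound (g := pdX (pdX G)) (τ₁ := 2 * τ) hc₂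
    (fun y t hy ht => (hH y t hy ht).2.2.2.1) hδ fun α => hG.decay α 0 2 _ _ hδ hlt 1 one_pos
  set C := C₀ + C₁ + C₂ with hC_def
  have hC : 0 ≤ C := by positivity
  have hdecay {K : ℝ × ℝ → ℂ} {C' : ℝ} (hK : ContinuousOn K (Ici 0 ×ˢ Ioi 0))
      (hle : C' ≤ C) (hb : ∀ σ ∈ s, ∀ y : ℝ, 0 < y → ‖K (y, σ)‖ ≤ C' * (1 + y ^ 2)⁻¹)
      {φ : ℂ → ℝ} (hφ : Continuous φ) (hφle : ∀ z, |φ z| ≤ ‖z‖) :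
      HasQuadraticDecay s C fun σ y => φ (K (y, σ)) := by
    refine fun σ hσ => ⟨hφ.comp_continuousOn (hK.comp (f := fun y : ℝ => (y, σ)) (by fun_prop)
      fun y hy => ⟨hy, hpos hσ⟩), fun y hy => (hφle _).trans ((hb σ hσ y hy).trans ?_)⟩
    gcongr
  have l₀ : C₀ ≤ C := by linarith
  have l₁ : C₁ ≤ C := by linarith
  have l₂ : C₂ ≤ C := by linarith
  have hre {f : ℝ → ℂ} {f' : ℂ} {x : ℝ} (h : HasDerivAt f f' x) :
      HasDerivAt (fun z => (f z).re) f'.re x :=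
    Complex.reCLM.hasFDerivAt.comp_hasDerivAt x h
  have him {f : ℝ → ℂ} {f' : ℂ} {x : ℝ} (h : HasDerivAt f f' x) :
      HasDerivAt (fun z => (f z).im) f'.im x :=
    Complex.imCLM.hasFDerivAt.comp_hasDerivAt x h
  have hbc : flatten G (0, τ) = 0 := by simpa [flatten] using hG.bc τ hτ
  set B : ℝ := 1 / (6 * (τ / 2) ^ 2) + 1 / (3 * (τ / 2) ^ 3) with hB_def
  have hbB (σ : ℝ) (hσ : σ ∈ s) : |-1 / (6 * σ ^ 2)| ≤ B :=
    (abs_neg_one_div_six_mul_sq_le hδ hσ.1).trans (le_add_of_nonneg_right (by positivity))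
  have hmain := _root_.hasDerivAt_weighted_mass (b := fun σ => -1 / (6 * σ ^ 2))
    (b' := fun σ => 1 / (3 * σ ^ 3)) (s := s) (τ := τ) (C := C) (B := B) hC hs hbB
    (fun σ hσ => by
      have := hpos hσ
      rw [abs_of_nonneg (by positivity)]
      refine le_trans ?_ (le_add_of_nonneg_left (by positivity))
      gcongr
      exact hσ.1)
    (fun σ hσ => hasDerivAt_neg_one_div_six_mul_sq (hpos hσ))
    (hdecay hc₀ l₀ hb₀ Complex.continuous_re Complex.abs_re_le_norm)
    (hdecay hc₁ l₁ hb₁ Complex.continuous_re Complex.abs_re_le_norm)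
    (hdecay hc₂ l₂ hb₂ Complex.continuous_re Complex.abs_re_le_norm)
    (hdecay hc₀ l₀ hb₀ Complex.continuous_im Complex.abs_im_le_norm)
    (hdecay hc₁ l₁ hb₁ Complex.continuous_im Complex.abs_im_le_norm)
    (hdecay hc₂ l₂ hb₂ Complex.continuous_im Complex.abs_im_le_norm)
    (fun σ hσ y hy => hre (hH y σ hy (hpos hσ)).1)
    (fun σ hσ y hy => him (hH y σ hy (hpos hσ)).1)
    (fun σ hσ y hy => hre (hH y σ hy (hpos hσ)).2.1)
    (fun σ hσ y hy => him (hH y σ hy (hpos hσ)).2.1)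
    (fun σ hσ y hy => by
      have h := hre (hH y σ hy (hpos hσ)).2.2.2.2
      rw [Complex.sub_re, Complex.re_ofReal_mul] at h
      convert! h using 1
      simp [Complex.mul_re]
      ring)
    (fun σ hσ y hy => by
      have h := him (hH y σ hy (hpos hσ)).2.2.2.2
      rw [Complex.sub_im, Complex.im_ofReal_mul] at h
      convert! h using 1
      simp [Complex.mul_im]
      ring)
    (by simp [hbc]) (by simp [hbc])
  set b := -1 / (6 * τ ^ 2) with hb_def
  refine ⟨_, hmain.congr_of_eventuallyEq (Eventually.of_forall fun σ => ?_), ?_, ?_⟩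
  · simp only [integral_Ioi_eq_integral_Ioi_zero _ (-1 / (6 * σ ^ 2)), norm_flatten_weight]
  · rw [← integral_complex_ofReal, integral_Ioi_eq_integral_Ioi_zero _ b, ← integral_const_mul]
    refine setIntegral_congr_fun measurableSet_Ioi fun y hy => ?_
    have h₁ : pdX G (y + b) τ = H₁ (y, τ) := (hH y τ hy hτ).2.2.1.symm
    have h₀ : G (y + b) τ = flatten G (y, τ) := rfl
    simp only [h₁, h₀]
    apply Complex.ext
    · simp [Complex.mul_re, Complex.mul_im]
      ring
    · simp [Complex.mul_re, Complex.mul_im]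
  · have hn₀ := hdecay hc₀ l₀ hb₀ continuous_norm fun z => (abs_norm z).le
    have hn₁ := hdecay hc₁ l₁ hb₁ continuous_norm fun z => (abs_norm z).le
    have k₀ := (hn₀ τ hτs).1.mono Ioi_subset_Ici_self
    have k₁ := (hn₁ τ hτs).1.mono Ioi_subset_Ici_self
    let f (y : ℝ) : ℝ := |y + b| * ‖flatten G (y, τ)‖
    let g (y : ℝ) : ℝ := ‖H₁ (y, τ)‖
    have hff : IntegrableOn (fun y => f y ^ 2) (Ioi 0) := by
      refine integrableOn_Ioi_of_le_inv (K := 2 * (1 + B) ^ 2 * C ^ 2) (by fun_prop)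
        fun y hy => ?_
      have := abs_mul_mul_le_of_le_inv (abs_add_mul_inv_le (y := y) (hbB τ hτs)).2 hC
        (by positivity) ((hn₀ τ hτs).2 y hy) ((hn₀ τ hτs).2 y hy)
      simpa only [f, mul_pow, sq_abs, pow_two ‖_‖] using this
    have hgg : IntegrableOn (fun y => g y ^ 2) (Ioi 0) := by
      refine integrableOn_Ioi_of_le_inv (K := 1 * C ^ 2) (by fun_prop) fun y hy => ?_
      have := abs_mul_mul_le_of_le_inv (x := 1) (M := 1) (e := (1 + y ^ 2)⁻¹)
        (by rw [abs_one, one_mul]; exact inv_le_one_of_one_le₀ (by nlinarith)) hC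
        (by positivity) ((hn₁ τ hτs).2 y hy) ((hn₁ τ hτs).2 y hy)
      simpa only [g, one_mul, pow_two ‖_‖] using this
    have hfg : IntegrableOn (fun y => f y * g y) (Ioi 0) := by
      refine integrableOn_Ioi_of_le_inv (K := 2 * (1 + B) ^ 2 * C ^ 2) (by fun_prop)
        fun y hy => ?_
      have := abs_mul_mul_le_of_le_inv (x := |y + b|)
        (M := 2 * (1 + B) ^ 2) (e := (1 + y ^ 2)⁻¹)
        (by rw [abs_abs]; exact (abs_add_mul_inv_le (y := y) (hbB τ hτs)).1) hC
        (by positivity) ((hn₀ τ hτs).2 y hy) ((hn₁ τ hτs).2 y hy)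
      simpa only [f, g, mul_assoc] using this
    have hW : trNormW G τ = √(∫ y in Ioi (0 : ℝ), f y ^ 2) := by
      rw [trNormW, integral_Ioi_eq_integral_Ioi_zero]
      simp only [f, mul_pow, sq_abs, flatten, b]
    have hN : trNorm (pdX G) τ = √(∫ y in Ioi (0 : ℝ), g y ^ 2) := by
      rw [trNorm, integral_Ioi_eq_integral_Ioi_zero]
      congr 1
      refine setIntegral_congr_fun measurableSet_Ioi fun y hy => ?_
      simp only [g, (hH y τ hy hτ).2.2.1, flatten]
    rw [hW, hN, ← Real.sqrt_mul (integral_nonneg fun y => sq_nonneg _)]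
    have hCS := Real.le_sqrt_of_sq_le (sq_integral_mul_le hff hgg hfg)
    refine le_trans ?_ (mul_le_mul_of_nonneg_left hCS two_pos.le)
    rw [← integral_const_mul, ← Real.norm_eq_abs]
    refine norm_integral_le_of_norm_le (hfg.const_mul 2) (Eventually.of_forall fun y => ?_)
    have him_le := Complex.abs_im_le_norm ((starRingEnd ℂ) (flatten G (y, τ)) * H₁ (y, τ))
    rw [norm_mul, RCLike.norm_conj, Complex.mul_im, Complex.conj_re, Complex.conj_im, neg_mul,
      ← sub_eq_add_neg] at him_le
    rw [Real.norm_eq_abs, abs_mul, abs_mul, abs_neg, abs_two]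
    simp only [f, g, mul_assoc]
    gcongr

/-- d/dτ ∫_{-1/(6τ²)}^{∞} η²|G|² dη
= i ∫_{-1/(6τ²)}^{∞} (η Ḡ G_η − η G Ḡ_η) dη, and consequently
I(τ) = (∫ η²|G|² dη)^{1/2} satisfies |I'(τ)| ≤ ‖∂_η G(·,τ)‖(τ) wherever I(τ) ≠ 0. -/
theorem statement7 (G : ℝ → ℝ → ℂ) (hG : IsAdmissibleTr G) :
    (∀ τ : ℝ, 0 < τ → ∃ D : ℝ,
      HasDerivAt (fun σ : ℝ => ∫ η in Set.Ioi (-1/(6*σ^2)), η^2 * ‖G η σ‖^2) D τ ∧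
      (D : ℂ) = Complex.I * ∫ (η : ℝ) in Set.Ioi (-1/(6*τ^2)),
        ((η:ℂ) * (starRingEnd ℂ) (G η τ) * pdX G η τ
          - (η:ℂ) * G η τ * (starRingEnd ℂ) (pdX G η τ))) ∧
    (∀ τ : ℝ, 0 < τ → trNormW G τ ≠ 0 → ∃ D' : ℝ,
      HasDerivAt (fun σ : ℝ => trNormW G σ) D' τ ∧ |D'| ≤ trNorm (pdX G) τ) := by
  refine ⟨fun τ hτ => ?_, fun τ hτ hne => ?_⟩
  · obtain ⟨D, hD, hD', -⟩ := hG.hasDerivAt_weighted_mass hτ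
    exact ⟨D, hD, hD'⟩
  · obtain ⟨D, hD, -, hle⟩ := hG.hasDerivAt_weighted_mass hτ
    have hpos : 0 < trNormW G τ := lt_of_le_of_ne (Real.sqrt_nonneg _) hne.symm
    refine ⟨_, hD.sqrt (Real.sqrt_pos.1 hpos).ne', ?_⟩
    change |D / (2 * trNormW G τ)| ≤ _
    rw [abs_div, abs_of_pos (by positivity : 0 < 2 * trNormW G τ), div_le_iff₀ (by positivity)]
    linarith
end
end

section
/- Let G : ℝ × (0,+∞) → ℂ be twice continuously differentiable, and for x ∈ ℝ, t > 0 define ψ(x,t) = t^{−1/2} exp{ i(7/120)t⁵ + (i/2)η t³ + (i/2)η² t } G(η,t), where η = x/t − t²/6. Then ψ satisfies i ∂ψ/∂t + (1/2) ∂²ψ/∂x² + x t ψ = 0 at a point (x,t) with t > 0 if and only if G satisfies i t² ∂G/∂t + (1/2) ∂²G/∂η² = 0 at the corresponding point (η,t). -/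
open MeasureTheory Filter Set Function

noncomputable section

/-- The searchlight phase `(7/120) t⁵ + η t³ / 2 + η² t / 2` with `η = x / t - t² / 6`. -/
def searchlightPhase (x t : ℝ) : ℂ :=
  (7/120) * (t:ℂ)^5 + ((x/t - t^2/6 : ℝ) : ℂ) * (t:ℂ)^3 / 2
    + ((x/t - t^2/6 : ℝ) : ℂ)^2 * (t:ℂ) / 2

theorem hasDerivAt_searchlightPhase_fst (x t : ℝ) (ht : 0 < t) :
    HasDerivAt (fun y => searchlightPhase y t)
      ((t:ℂ)^2 / 2 + ((x/t - t^2/6 : ℝ) : ℂ)) x := by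
  have htc : (t:ℂ) ≠ 0 := by exact_mod_cast ht.ne'
  have hη : HasDerivAt (fun y : ℝ => ((y/t - t^2/6 : ℝ) : ℂ)) ((1/t : ℝ) : ℂ) x :=
    (((hasDerivAt_id x).div_const t).sub_const (t^2/6)).ofReal_comp
  have h := (((hη.mul_const ((t:ℂ)^3)).div_const 2).const_add ((7/120) * (t:ℂ)^5)).add
    (((hη.pow 2).mul_const (t:ℂ)).div_const 2)
  refine h.congr_deriv ?_
  push_cast
  field_simp

theorem hasDerivAt_div_sub_sq (x t : ℝ) (ht : 0 < t) :
    HasDerivAt (fun s : ℝ => x/s - s^2/6) (-x/t^2 - t/3) t := by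
  have h := ((hasDerivAt_const t x).div (hasDerivAt_id t) ht.ne').sub
    (((hasDerivAt_id t).pow 2).div_const 6)
  refine h.congr_deriv ?_
  simp only [id]
  field_simp
  norm_num
  ring

theorem hasDerivAt_searchlightPhase_snd (x t : ℝ) (ht : 0 < t) :
    HasDerivAt (fun s => searchlightPhase x s)
      ((7/24) * (t:ℂ)^4 + 3/2 * ((x/t - t^2/6 : ℝ) : ℂ) * (t:ℂ)^2
        + ((x/t - t^2/6 : ℝ) : ℂ)^2 / 2
        - (((x/t - t^2/6 : ℝ) : ℂ) + (t:ℂ)^2/2)^2) t := by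
  have htc : (t:ℂ) ≠ 0 := by exact_mod_cast ht.ne'
  have hη : HasDerivAt (fun s : ℝ => ((x/s - s^2/6 : ℝ) : ℂ)) ((-x/t^2 - t/3 : ℝ) : ℂ) t :=
    (hasDerivAt_div_sub_sq x t ht).ofReal_comp
  have hs : HasDerivAt (fun s : ℝ => (s:ℂ)) 1 t := by
    simpa using (hasDerivAt_id t).ofReal_comp
  have h := (((hs.pow 5).const_mul (7/120)).add ((hη.mul (hs.pow 3)).div_const 2)).add
    (((hη.pow 2).mul hs).div_const 2)
  refine h.congr_deriv ?_
  simp only [Pi.pow_apply]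
  push_cast
  field_simp
  ring

theorem hasDerivAt_ofReal_inv_sqrt (t : ℝ) (ht : 0 < t) :
    HasDerivAt (fun s : ℝ => (((Real.sqrt s)⁻¹ : ℝ) : ℂ))
      (-(((Real.sqrt t)⁻¹ : ℝ) : ℂ) / (2 * t)) t := by
  have h := ((Real.hasDerivAt_sqrt ht.ne').inv (Real.sqrt_pos.2 ht).ne').ofReal_comp
  refine h.congr_deriv ?_
  rw [Real.sq_sqrt ht.le]
  have hsc : ((Real.sqrt t : ℝ) : ℂ) ≠ 0 := by exact_mod_cast (Real.sqrt_pos.2 ht).ne'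
  have htc : (t:ℂ) ≠ 0 := by exact_mod_cast ht.ne'
  push_cast
  field_simp

/-- the searchlight change of variables
ψ(x,t) = t^{-1/2} exp{i(7/120)t⁵ + (i/2)η t³ + (i/2)η² t} G(η,t), η = x/t − t²/6,
turns the equation i ψ_t + (1/2) ψ_xx + x t ψ = 0 (at a point with t > 0) into
i t² G_t + (1/2) G_ηη = 0 at the corresponding point, and conversely. -/
theorem statement15 (G : ℝ → ℝ → ℂ)
    (hG : ContDiffOn ℝ 2 (Function.uncurry G) {p : ℝ × ℝ | 0 < p.2})
    (x t : ℝ) (ht : 0 < t) :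
    (Complex.I * pdT (fun x' t' : ℝ =>
          (((Real.sqrt t')⁻¹ : ℝ) : ℂ) *
            Complex.exp (Complex.I * ((7/120) * (t':ℂ)^5
              + ((x'/t' - t'^2/6 : ℝ) : ℂ) * (t':ℂ)^3 / 2
              + ((x'/t' - t'^2/6 : ℝ) : ℂ)^2 * (t':ℂ) / 2))
            * G (x'/t' - t'^2/6) t') x t
        + (1/2) * pdX (pdX (fun x' t' : ℝ =>
          (((Real.sqrt t')⁻¹ : ℝ) : ℂ) *
            Complex.exp (Complex.I * ((7/120) * (t':ℂ)^5
              + ((x'/t' - t'^2/6 : ℝ) : ℂ) * (t':ℂ)^3 / 2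
              + ((x'/t' - t'^2/6 : ℝ) : ℂ)^2 * (t':ℂ) / 2))
            * G (x'/t' - t'^2/6) t')) x t
        + (x:ℂ) * (t:ℂ) * ((((Real.sqrt t)⁻¹ : ℝ) : ℂ) *
            Complex.exp (Complex.I * ((7/120) * (t:ℂ)^5
              + ((x/t - t^2/6 : ℝ) : ℂ) * (t:ℂ)^3 / 2
              + ((x/t - t^2/6 : ℝ) : ℂ)^2 * (t:ℂ) / 2))
            * G (x/t - t^2/6) t) = 0)
    ↔ (Complex.I * (t:ℂ)^2 * pdT G (x/t - t^2/6) t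
        + (1/2) * pdX (pdX G) (x/t - t^2/6) t = 0) := by
  have htc : (t:ℂ) ≠ 0 := by exact_mod_cast ht.ne'
  have hopen : IsOpen {p : ℝ × ℝ | 0 < p.2} := isOpen_lt continuous_const continuous_snd
  have hslice : ContDiff ℝ 2 (fun y => G y t) :=
    hG.comp_contDiff (f := fun y : ℝ => (y, t)) (contDiff_id.prodMk contDiff_const)
      (fun _ => ht)
  have hG1 (y : ℝ) : HasDerivAt (fun y => G y t) (pdX G y t) y :=
    (hslice.differentiable (by norm_num) y).hasDerivAt
  have hG2 (y : ℝ) : HasDerivAt (fun y => pdX G y t) (pdX (pdX G) y t) y := by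
    have h : ContDiff ℝ 1 (deriv fun y => G y t) :=
      (contDiff_succ_iff_deriv (n := 1).1 (by simpa [one_add_one_eq_two] using hslice)).2.2
    exact (h.differentiable (by norm_num) y).hasDerivAt
  have hη (y : ℝ) : HasDerivAt (fun y : ℝ => y/t - t^2/6) (1/t) y :=
    ((hasDerivAt_id y).div_const t).sub_const (t^2/6)
  have hGη (y : ℝ) : HasDerivAt (fun y => G (y/t - t^2/6) t)
      (pdX G (y/t - t^2/6) t / t) y := by
    refine ((hG1 _).scomp y (hη y)).congr_deriv ?_
    rw [Complex.real_smul]; push_cast; ring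
  have hGηη (y : ℝ) : HasDerivAt (fun y => pdX G (y/t - t^2/6) t)
      (pdX (pdX G) (y/t - t^2/6) t / t) y := by
    refine ((hG2 _).scomp y (hη y)).congr_deriv ?_
    rw [Complex.real_smul]; push_cast; ring
  have hGt : HasDerivAt (fun s => G (x/s - s^2/6) s)
      (((-x/t^2 - t/3 : ℝ) : ℂ) * pdX G (x/t - t^2/6) t + pdT G (x/t - t^2/6) t) t := by
    have hF : DifferentiableAt ℝ (uncurry G) (x/t - t^2/6, t) :=
      (hG.differentiableOn (by norm_num)).differentiableAt (hopen.mem_nhds ht)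
    have h1 : fderiv ℝ (uncurry G) (x/t - t^2/6, t) (1, 0) = pdX G (x/t - t^2/6) t :=
      (hF.hasFDerivAt.comp_hasDerivAt (f := fun y => (y, t)) (x/t - t^2/6)
        ((hasDerivAt_id _).prodMk (hasDerivAt_const _ t))).deriv.symm
    have h2 : fderiv ℝ (uncurry G) (x/t - t^2/6, t) (0, 1) = pdT G (x/t - t^2/6) t :=
      (hF.hasFDerivAt.comp_hasDerivAt (f := fun s => (x/t - t^2/6, s)) t
        ((hasDerivAt_const t _).prodMk (hasDerivAt_id t))).deriv.symm
    have h := hF.hasFDerivAt.comp_hasDerivAt (f := fun s => (x/s - s^2/6, s)) t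
      ((hasDerivAt_div_sub_sq x t ht).prodMk (hasDerivAt_id t))
    refine h.congr_deriv ?_
    have hv : ((-x/t^2 - t/3, 1) : ℝ × ℝ) = (-x/t^2 - t/3) • ((1, 0) : ℝ × ℝ) + (0, 1) := by
      simp
    rw [hv, map_add, map_smul, h1, h2, Complex.real_smul]
  have hE (y : ℝ) : HasDerivAt (fun y => Complex.exp (Complex.I * searchlightPhase y t)) _ y :=
    ((hasDerivAt_searchlightPhase_fst y t ht).const_mul Complex.I).cexp
  have hψx (y : ℝ) := ((hE y).const_mul (((Real.sqrt t)⁻¹ : ℝ) : ℂ)).mul (hGη y)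
  have hφ (y : ℝ) : HasDerivAt (fun y : ℝ => (t:ℂ)^2 / 2 + ((y/t - t^2/6 : ℝ) : ℂ))
      ((1/t : ℝ) : ℂ) y := (hη y).ofReal_comp.const_add _
  have hψxx := ((((hE x).mul ((hφ x).const_mul Complex.I)).const_mul
      (((Real.sqrt t)⁻¹ : ℝ) : ℂ)).mul (hGη x)).add
    (((hE x).const_mul (((Real.sqrt t)⁻¹ : ℝ) : ℂ)).mul ((hGηη x).div_const (t:ℂ)))
  have hψt := ((hasDerivAt_ofReal_inv_sqrt t ht).mul
    ((hasDerivAt_searchlightPhase_snd x t ht).const_mul Complex.I).cexp).mul hGt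
  change (Complex.I * deriv (fun s => (((Real.sqrt s)⁻¹ : ℝ) : ℂ) *
      Complex.exp (Complex.I * searchlightPhase x s) * G (x/s - s^2/6) s) t
    + (1/2) * deriv (fun y => deriv (fun z => (((Real.sqrt t)⁻¹ : ℝ) : ℂ) *
      Complex.exp (Complex.I * searchlightPhase z t) * G (z/t - t^2/6) t) y) x
    + (x:ℂ) * (t:ℂ) * ((((Real.sqrt t)⁻¹ : ℝ) : ℂ) *
      Complex.exp (Complex.I * searchlightPhase x t) * G (x/t - t^2/6) t) = 0) ↔ _
  have hψx' := funext fun y => (hψx y).deriv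
  have hψt' := hψt.deriv
  have hψxx' := hψxx.deriv
  simp only [Pi.mul_def, Pi.add_def] at hψx' hψt' hψxx'
  rw [hψx', hψt', hψxx']
  have hne : (((Real.sqrt t)⁻¹ : ℝ) : ℂ) * Complex.exp (Complex.I * searchlightPhase x t)
      / (t:ℂ)^2 ≠ 0 := by
    have : (((Real.sqrt t)⁻¹ : ℝ) : ℂ) ≠ 0 := by
      exact_mod_cast (inv_pos.2 (Real.sqrt_pos.2 ht)).ne'
    exact div_ne_zero (mul_ne_zero this (Complex.exp_ne_zero _)) (pow_ne_zero 2 htc)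
  refine Iff.trans ?_ (mul_eq_zero_iff_left hne)
  generalize Complex.exp (Complex.I * searchlightPhase x t) = E
  generalize pdX (pdX G) (x/t - t^2/6) t = g₂
  generalize pdX G (x/t - t^2/6) t = g₁
  generalize pdT G (x/t - t^2/6) t = gt
  generalize G (x/t - t^2/6) t = g
  generalize (((Real.sqrt t)⁻¹ : ℝ) : ℂ) = A
  have hI : Complex.I ^ 2 = -1 := Complex.I_sq
  refine Eq.congr_left ?_
  push_cast
  field_simp
  ring_nf
  simp only [hI]
  ring
end
end

section
/- Let φ : ℝ² → ℂ be twice continuously differentiable, and define ψ(x,t) = exp{ (i/2)ζ t² + i(7/120)t⁵ } φ(ζ,t), where ζ = x − t³/6. Then ψ satisfies the Schrödinger-type equation i ∂ψ/∂t + (1/2) ∂²ψ/∂x² + x t ψ = 0 at a point (x,t) if and only if φ satisfies the free Schrödinger (parabolic wave) equation i ∂φ/∂t + (1/2) ∂²φ/∂ζ² = 0 at the corresponding point (ζ,t). -/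
open MeasureTheory Filter Set Function

noncomputable section

/-- Chain rule along a graph curve `s ↦ (a s, s)`, in terms of the partial derivatives. -/
theorem hasDerivAt_along_graph {f : ℝ → ℝ → ℂ} {a : ℝ → ℝ} {a' t : ℝ}
    (hf : DifferentiableAt ℝ (Function.uncurry f) (a t, t)) (ha : HasDerivAt a a' t) :
    HasDerivAt (fun s => f (a s) s) (a' * pdX f (a t) t + pdT f (a t) t) t := by
  set L := fderiv ℝ (Function.uncurry f) (a t, t)
  have hL : HasFDerivAt (Function.uncurry f) L (a t, t) := hf.hasFDerivAt
  have hX : pdX f (a t) t = L (1, 0) := by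
    have h : HasDerivAt (fun y : ℝ => (y, t)) ((1 : ℝ), (0 : ℝ)) (a t) :=
      (hasDerivAt_id _).prodMk (hasDerivAt_const _ _)
    exact (HasFDerivAt.comp_hasDerivAt (a t) hL h).deriv
  have hT : pdT f (a t) t = L (0, 1) := by
    have h : HasDerivAt (fun s : ℝ => (a t, s)) ((0 : ℝ), (1 : ℝ)) t :=
      (hasDerivAt_const _ _).prodMk (hasDerivAt_id _)
    exact (HasFDerivAt.comp_hasDerivAt t hL h).deriv
  have h : HasDerivAt (fun s : ℝ => (a s, s)) (a', (1 : ℝ)) t := ha.prodMk (hasDerivAt_id _)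
  refine (HasFDerivAt.comp_hasDerivAt (f := fun s : ℝ => (a s, s)) t hL h).congr_deriv ?_
  have hsplit : ((a', 1) : ℝ × ℝ) = a' • ((1 : ℝ), (0 : ℝ)) + ((0 : ℝ), (1 : ℝ)) := by simp
  rw [hX, hT, hsplit, map_add, map_smul, Complex.real_smul]

theorem contDiff_slice_left {n : WithTop ℕ∞} {f : ℝ → ℝ → ℂ}
    (hf : ContDiff ℝ n (Function.uncurry f)) (t : ℝ) : ContDiff ℝ n (fun y => f y t) :=
  hf.comp (contDiff_id.prodMk contDiff_const)

theorem hasDerivAt_pdX {f : ℝ → ℝ → ℂ}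
    (hf : ContDiff ℝ 2 (Function.uncurry f)) (z t : ℝ) :
    HasDerivAt (fun y => f y t) (pdX f z t) z :=
  ((contDiff_slice_left hf t).differentiable (by norm_num) z).hasDerivAt

theorem hasDerivAt_pdX_pdX {f : ℝ → ℝ → ℂ}
    (hf : ContDiff ℝ 2 (Function.uncurry f)) (z t : ℝ) :
    HasDerivAt (fun y => pdX f y t) (pdX (pdX f) z t) z :=
  ((contDiff_slice_left hf t).differentiable_deriv_two z).hasDerivAt

/-- Derivative of a function of the form `y ↦ exp (i (y - c) t² / 2 + d) g (y - c)`. -/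
theorem hasDerivAt_exp_mul_shift {g : ℝ → ℂ} {g' : ℂ} (c t : ℝ) (d : ℂ) {x : ℝ}
    (hg : HasDerivAt g g' (x - c)) :
    HasDerivAt (fun y : ℝ =>
        Complex.exp ((Complex.I/2) * ((y - c : ℝ) : ℂ) * (t:ℂ)^2 + d) * g (y - c))
      (Complex.exp ((Complex.I/2) * ((x - c : ℝ) : ℂ) * (t:ℂ)^2 + d)
        * ((Complex.I/2) * (t:ℂ)^2 * g (x - c) + g')) x := by
  have hshift : HasDerivAt (fun y : ℝ => ((y - c : ℝ) : ℂ)) 1 x := by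
    simpa using ((hasDerivAt_id x).sub_const c).ofReal_comp
  have hexp := (((hshift.const_mul (Complex.I/2)).mul_const ((t:ℂ)^2)).add_const d).cexp
  have hg' : HasDerivAt (fun y : ℝ => g (y - c)) g' x := hg.comp_sub_const x c
  refine (hexp.mul hg').congr_deriv ?_
  ring

/-- the change of variables
ψ(x,t) = exp{(i/2)ζ t² + i(7/120)t⁵} φ(ζ,t), ζ = x − t³/6,
turns i ψ_t + (1/2) ψ_xx + x t ψ = 0 into the free Schrödinger (parabolic wave)
equation i φ_t + (1/2) φ_ζζ = 0 at the corresponding point, and conversely. -/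
theorem statement16 (φ : ℝ → ℝ → ℂ)
    (hφ : ContDiff ℝ 2 (Function.uncurry φ)) (x t : ℝ) :
    (Complex.I * pdT (fun x' t' : ℝ =>
          Complex.exp ((Complex.I/2) * ((x' - t'^3/6 : ℝ) : ℂ) * (t':ℂ)^2
              + Complex.I * (7/120) * (t':ℂ)^5)
            * φ (x' - t'^3/6) t') x t
        + (1/2) * pdX (pdX (fun x' t' : ℝ =>
          Complex.exp ((Complex.I/2) * ((x' - t'^3/6 : ℝ) : ℂ) * (t':ℂ)^2
              + Complex.I * (7/120) * (t':ℂ)^5)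
            * φ (x' - t'^3/6) t')) x t
        + (x:ℂ) * (t:ℂ) * (Complex.exp ((Complex.I/2) * ((x - t^3/6 : ℝ) : ℂ) * (t:ℂ)^2
              + Complex.I * (7/120) * (t:ℂ)^5)
            * φ (x - t^3/6) t) = 0)
    ↔ (Complex.I * pdT φ (x - t^3/6) t
        + (1/2) * pdX (pdX φ) (x - t^3/6) t = 0) := by
  set c := t^3/6 with hc
  set d : ℂ := Complex.I * (7/120) * (t:ℂ)^5 with hd
  set ζ := x - c with hζ
  set E := Complex.exp ((Complex.I/2) * (ζ : ℂ) * (t:ℂ)^2 + d) with hE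
  set ψ : ℝ → ℝ → ℂ := fun x' t' : ℝ =>
          Complex.exp ((Complex.I/2) * ((x' - t'^3/6 : ℝ) : ℂ) * (t':ℂ)^2
              + Complex.I * (7/120) * (t':ℂ)^5)
            * φ (x' - t'^3/6) t' with hψ
  have hψX (y : ℝ) : pdX ψ y t = Complex.exp ((Complex.I/2) * ((y - c : ℝ) : ℂ) * (t:ℂ)^2 + d)
      * ((Complex.I/2) * (t:ℂ)^2 * φ (y - c) t + pdX φ (y - c) t) :=
    (hasDerivAt_exp_mul_shift c t d (hasDerivAt_pdX hφ (y - c) t)).deriv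
  have hψXX : pdX (pdX ψ) x t = E
      * ((Complex.I/2) * (t:ℂ)^2 * ((Complex.I/2) * (t:ℂ)^2 * φ ζ t + pdX φ ζ t)
        + ((Complex.I/2) * (t:ℂ)^2 * pdX φ ζ t + pdX (pdX φ) ζ t)) := by
    have hψX' : (fun y => pdX ψ y t) = _ := funext hψX
    change deriv (fun y => pdX ψ y t) x = _
    rw [hψX']
    exact (hasDerivAt_exp_mul_shift
      (g := fun z => (Complex.I/2) * (t:ℂ)^2 * φ z t + pdX φ z t) c t d
      (((hasDerivAt_pdX hφ ζ t).const_mul _).add (hasDerivAt_pdX_pdX hφ ζ t))).deriv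
  have hψT : pdT ψ x t = E
      * (Complex.I * (ζ * t + t^4/24) * φ ζ t - t^2/2 * pdX φ ζ t + pdT φ ζ t) := by
    have hcurve : HasDerivAt (fun s : ℝ => x - s^3/6) (-(t^2/2)) t := by
      refine (((hasDerivAt_pow 3 t).div_const 6).const_sub x).congr_deriv ?_
      push_cast
      ring
    have hcast : HasDerivAt (fun s : ℝ => (s : ℂ)) 1 t := Complex.ofRealCLM.hasDerivAt
    have hexp := (((hcurve.ofReal_comp.const_mul (Complex.I/2)).mul (hcast.pow 2)).add
      ((hcast.pow 5).const_mul (Complex.I * (7/120)))).cexp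
    have hφT := hasDerivAt_along_graph
      (hφ.differentiable (by norm_num) (x - t^3/6, t)) hcurve
    refine ((hexp.mul hφT).congr_deriv ?_).deriv
    simp only [Pi.add_apply, Pi.mul_apply, Pi.pow_apply, ← hc, ← hζ, ← hd, ← hE]
    push_cast
    ring
  have hx : (x : ℂ) = ζ + t^3/6 := by
    rw [hζ, hc]
    push_cast
    ring
  have key : Complex.I * pdT ψ x t + (1/2) * pdX (pdX ψ) x t + (x:ℂ) * (t:ℂ) * (E * φ ζ t)
      = E * (Complex.I * pdT φ ζ t + (1/2) * pdX (pdX φ) ζ t) := by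
    rw [hψT, hψXX, hx]
    linear_combination (E * φ ζ t * (ζ * t + t^4/24 + t^4/8)) * Complex.I_sq
  rw [key, mul_eq_zero, or_iff_right (Complex.exp_ne_zero _)]
end
end
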